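/- arXiv:1502.06840 — 4 statements merged into one kernel-verified Lean document; each statement's English description precedes it below -/
import Mathlib

section
/- Let G be a finite group whose derived subgroup G′ is nilpotent. Then md(G) = m(G), i.e. the maximum size of a family of maximal subgroups of G in general position equals the maximum size of an irredundant generating sequence of G. -/
/-- A sequence `(g 0, …, g (n-1))` of elements of a group `G` is *irredundant* if for every
`i`, the subgroup generated by the `g j` with `j ≠ i` is properly contained in the subgroup
generated by all the `g j`. -/
def Irredundant {G : Type*} [Group G] {n : ℕ} (g : Fin n → G) : Prop :=
  ∀ i : Fin n, Subgroup.closure (g '' {j | j ≠ i}) < Subgroup.closure (Set.range g)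

/-- `mInv G` is the maximum size of an irredundant generating sequence of `G`. -/
noncomputable def mInv (G : Type*) [Group G] : ℕ :=
  sSup {n | ∃ g : Fin n → G, Irredundant g ∧ Subgroup.closure (Set.range g) = ⊤}

/-- A family of subgroups `H i` of `G` is in *general position* if for every index `i`,
the intersection of the `H j` with `j ≠ i` properly contains the intersection of all the
`H j`. -/
def GeneralPosition {G : Type*} [Group G] {ι : Type*} (H : ι → Subgroup G) : Prop :=
  ∀ i : ι, (⨅ j, H j) < ⨅ j ∈ ({i}ᶜ : Set ι), H j

/-- `mdInv G` is the maximum size of a family of maximal subgroups of `G` in general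
position. -/
noncomputable def mdInv (G : Type*) [Group G] : ℕ :=
  sSup {n | ∃ M : Fin n → Subgroup G, (∀ i, IsCoatom (M i)) ∧ GeneralPosition M}

open scoped commutatorElement

/-- A set generates `G` irredundantly if it generates `G` and none of its elements lies in the
subgroup generated by the others. -/
def IsIrredundantGenSet {G : Type*} [Group G] (S : Set G) : Prop :=
  Subgroup.closure S = ⊤ ∧ ∀ x ∈ S, x ∉ Subgroup.closure (S \ {x})

/-- Every generating set of a finite group contains an irredundant one. -/
theorem exists_isIrredundantGenSet_subset {G : Type*} [Group G] [Finite G] {T : Set G}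
    (hT : Subgroup.closure T = ⊤) : ∃ S ⊆ T, IsIrredundantGenSet S := by
  obtain ⟨S, hST, hS⟩ := exists_minimal_le_of_wellFoundedLT
    (fun S : Set G => Subgroup.closure S = ⊤) T hT
  refine ⟨S, hST, hS.prop, fun x hx hmem => ?_⟩
  have h1 : Subgroup.closure (S \ {x}) = ⊤ := by
    refine top_unique (hS.prop.ge.trans ((Subgroup.closure_le _).2 fun y hy => ?_))
    by_cases hyx : y = x
    · exact hyx ▸ hmem
    · exact Subgroup.subset_closure ⟨hy, hyx⟩
  exact (hS.le_of_le h1 Set.sdiff_subset hx).2 rfl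

/-- An irredundant generating set of a quotient lifts to one of at least the same size; if the
lifts can be chosen in a proper subgroup, then to a strictly larger one. -/
theorem IsIrredundantGenSet.exists_lift {G Q : Type*} [Group G] [Finite G] [Group Q]
    (f : G →* Q) (H : Subgroup G) (hH : H.map f = ⊤) {S : Set Q} (hS : IsIrredundantGenSet S) :
    ∃ T : Set G, IsIrredundantGenSet T ∧ S.ncard ≤ T.ncard ∧ (H ≠ ⊤ → S.ncard + 1 ≤ T.ncard) := by
  have hlift : ∀ q : Q, ∃ g ∈ H, f g = q := fun q => by
    have : q ∈ H.map f := hH ▸ Subgroup.mem_top q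
    simpa using this
  choose l hlH hl using hlift
  have hfin : Finite Q := Finite.of_injective l (Function.LeftInverse.injective hl)
  have hgen : Subgroup.closure (l '' S ∪ f.ker) = ⊤ := by
    have hker : f.ker ≤ Subgroup.closure (l '' S ∪ f.ker) :=
      fun g hg => Subgroup.subset_closure (Or.inr hg)
    rw [← Subgroup.comap_map_eq_self hker]
    have : (Subgroup.closure (l '' S ∪ f.ker)).map f = ⊤ := by
      refine top_unique (hS.1.ge.trans ((Subgroup.closure_le _).2 fun q hq => ?_))
      exact ⟨l q, Subgroup.subset_closure (Or.inl ⟨q, hq, rfl⟩), hl q⟩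
    rw [this, Subgroup.comap_top]
  obtain ⟨T, hTsub, hT⟩ := exists_isIrredundantGenSet_subset hgen
  have hST : l '' S ⊆ T := by
    rintro _ ⟨q, hq, rfl⟩
    by_contra hqT
    apply hS.2 q hq
    have h1 : (Subgroup.closure T).map f ≤ Subgroup.closure (S \ {q}) := by
      rw [MonoidHom.map_closure, Subgroup.closure_le]
      rintro _ ⟨t, ht, rfl⟩
      rcases hTsub ht with ⟨r, hr, rfl⟩ | hk
      · refine Subgroup.subset_closure ⟨by rwa [hl], fun h => hqT ?_⟩
        rw [hl] at h
        exact h ▸ ht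
      · have : f t = 1 := hk
        simp [this]
    exact h1 ⟨l q, hT.1 ▸ Subgroup.mem_top _, hl q⟩
  have hcard : (l '' S).ncard = S.ncard :=
    Set.ncard_image_of_injective S (Function.LeftInverse.injective hl)
  refine ⟨T, hT, hcard ▸ Set.ncard_le_ncard hST, fun hne => ?_⟩
  rw [← hcard]
  refine Set.ncard_lt_ncard (hST.ssubset_of_ne fun h => hne ?_)
  rw [eq_top_iff, ← hT.1, ← h, Subgroup.closure_le]
  rintro _ ⟨q, -, rfl⟩
  exact hlH q

/-- An irredundant generating set of a proper complement of a normal subgroup yields a strictly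
larger one of the whole group. -/
theorem IsIrredundantGenSet.exists_of_complement {G : Type*} [Group G] [Finite G]
    {N M : Subgroup G} [N.Normal] (hdisj : N ⊓ M = ⊥) (hsup : N ⊔ M = ⊤) (hM : M ≠ ⊤)
    {S : Set M} (hS : IsIrredundantGenSet S) :
    ∃ T : Set G, IsIrredundantGenSet T ∧ S.ncard + 1 ≤ T.ncard := by
  have hmap : M.map (QuotientGroup.mk' N) = ⊤ := by
    rw [← bot_sup_eq (M.map _), ← (Subgroup.map_eq_bot_iff N).2 (QuotientGroup.ker_mk' N).ge,
      ← Subgroup.map_sup, hsup, Subgroup.map_top_of_surjective _ (QuotientGroup.mk'_surjective N)]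
  let φ : M →* G ⧸ N := (QuotientGroup.mk' N).comp M.subtype
  have hφ : Function.Bijective φ := by
    constructor
    · rw [injective_iff_map_eq_one]
      intro m hm
      have hmN : (m : G) ∈ N := (QuotientGroup.eq_one_iff (m : G)).1 hm
      have : (m : G) ∈ N ⊓ M := ⟨hmN, m.2⟩
      rw [hdisj, Subgroup.mem_bot] at this
      exact Subtype.ext this
    · rw [← MonoidHom.range_eq_top, MonoidHom.range_comp, Subgroup.range_subtype, hmap]
  let ψ := (MulEquiv.ofBijective φ hφ).symm
  obtain ⟨S', hS', hle, -⟩ := hS.exists_lift ψ.toMonoidHom ⊤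
    (Subgroup.map_top_of_surjective _ ψ.surjective)
  obtain ⟨T, hT, -, hlt⟩ := hS'.exists_lift (QuotientGroup.mk' N) M hmap
  exact ⟨T, hT, (Nat.succ_le_succ hle).trans (hlt hM)⟩

theorem exists_forall_eq_zsmul_of_prime_pow {p e : ℕ} (hp : p.Prime) {ι : Type*} [Finite ι]
    [Nonempty ι] (c : ι → ZMod (p ^ e)) : ∃ i, ∀ j, ∃ k : ℤ, c j = k • c i := by
  have : NeZero (p ^ e) := ⟨pow_ne_zero _ hp.ne_zero⟩
  obtain ⟨i, hi⟩ := Finite.exists_min fun i => Nat.gcd (c i).val (p ^ e)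
  refine ⟨i, fun j => ?_⟩
  obtain ⟨a, -, ha⟩ := (Nat.dvd_prime_pow hp).1 (Nat.gcd_dvd_right (c i).val (p ^ e))
  obtain ⟨b, -, hb⟩ := (Nat.dvd_prime_pow hp).1 (Nat.gcd_dvd_right (c j).val (p ^ e))
  have hab : p ^ a ≤ p ^ b := by simpa only [ha, hb] using hi j
  have hdvd : Nat.gcd (c i).val (p ^ e) ∣ (c j).val := by
    rw [ha]
    refine (pow_dvd_pow p ((Nat.pow_le_pow_iff_right hp.one_lt).1 hab)).trans ?_
    rw [← hb]
    exact Nat.gcd_dvd_left _ _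
  obtain ⟨x, y, hxy⟩ := Int.gcd_dvd_iff.1
    (show Int.gcd ((c i).val : ℤ) ((p ^ e : ℕ) : ℤ) ∣ (c j).val from hdvd)
  refine ⟨x, ?_⟩
  have h3 := congrArg (fun z : ℤ => (z : ZMod (p ^ e))) hxy
  simp only [Int.cast_natCast, ZMod.natCast_zmod_val, Int.cast_add, Int.cast_mul,
    ZMod.natCast_self, zero_mul, add_zero] at h3
  rw [h3, zsmul_eq_mul, mul_comm]

/-- A nontrivial finite commutative group has a nontrivial cyclic direct factor of prime power
order. -/
theorem exists_retraction_zmod_prime_pow {G : Type*} [CommGroup G] [Finite G] [Nontrivial G] :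
    ∃ (p e : ℕ) (f : G →* Multiplicative (ZMod (p ^ e))) (s : Multiplicative (ZMod (p ^ e)) →* G),
      p.Prime ∧ e ≠ 0 ∧ f.comp s = MonoidHom.id _ := by
  classical
  obtain ⟨ι, _, p, hp, e, ⟨φ⟩⟩ := AddCommGroup.equiv_directSum_zmod_of_finite (Additive G)
  have : ∃ i, e i ≠ 0 := by
    by_contra! h
    obtain ⟨a, b, hab⟩ := exists_pair_ne G
    apply hab
    apply Additive.ofMul.injective
    apply φ.injective
    ext i : 1
    have : Subsingleton (ZMod (p i ^ e i)) := by
      rw [h i, pow_zero]; infer_instance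
    exact Subsingleton.elim _ _
  obtain ⟨i, hi⟩ := this
  refine ⟨p i, e i, AddMonoidHom.toMultiplicativeRight
    (((DirectSum.component ℤ ι (fun i => ZMod (p i ^ e i)) i).toAddMonoidHom).comp φ.toAddMonoidHom),
    AddMonoidHom.toMultiplicativeLeft
    (φ.symm.toAddMonoidHom.comp (DirectSum.of (fun i => ZMod (p i ^ e i)) i)), hp i, hi, ?_⟩
  refine MonoidHom.ext fun x => ?_
  have h1 : φ (φ.symm (DirectSum.of (fun i => ZMod (p i ^ e i)) i x.toAdd)) i = x.toAdd := by
    rw [φ.apply_symm_apply, DirectSum.of_eq_same]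
  exact congrArg Multiplicative.ofAdd h1

theorem natCard_eq_natCard_ne_add_one {ι : Type*} [Finite ι] (i : ι) :
    Nat.card ι = Nat.card {j // j ≠ i} + 1 := by
  classical
  rw [← Finite.card_option, Nat.card_congr (Equiv.optionSubtypeNe i)]

/-- In a finite commutative group, the size of an irredundant family is at most that of some
irredundant generating set. -/
theorem exists_isIrredundantGenSet_of_commGroup {n : ℕ} {G : Type*} [CommGroup G] [Finite G]
    (hn : Nat.card G = n) {ι : Type*} [Finite ι] (x : ι → G)
    (hx : ∀ i, x i ∉ Subgroup.closure (x '' {j | j ≠ i})) :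
    ∃ S : Set G, IsIrredundantGenSet S ∧ Nat.card ι ≤ S.ncard := by
  induction n using Nat.strong_induction_on generalizing G ι with
  | _ n ih =>
  rcases isEmpty_or_nonempty ι with hι | hι
  · obtain ⟨S, -, hS⟩ := exists_isIrredundantGenSet_subset (T := (Set.univ : Set G))
      Subgroup.closure_univ
    exact ⟨S, hS, by simp⟩
  rcases subsingleton_or_nontrivial G with hG | hG
  · obtain ⟨i⟩ := hι
    exact absurd (Subsingleton.elim (1 : G) (x i) ▸ one_mem _) (hx i)
  obtain ⟨p, e, f, s, hp, he, hfs⟩ := exists_retraction_zmod_prime_pow (G := G)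
  have hfs' : ∀ c, f (s c) = c := fun c => DFunLike.congr_fun hfs c
  have hdisj : s.range ⊓ f.ker = ⊥ := by
    rw [eq_bot_iff]
    rintro _ ⟨⟨c, rfl⟩, hc⟩
    have hc1 : f (s c) = 1 := hc
    rw [hfs'] at hc1
    simp [hc1]
  have hsup : s.range ⊔ f.ker = ⊤ := by
    rw [eq_top_iff]
    intro g _
    have : g = s (f g) * ((s (f g))⁻¹ * g) := by group
    rw [this]
    refine Subgroup.mul_mem_sup ⟨_, rfl⟩ ?_
    simp [MonoidHom.mem_ker, hfs']
  have hker : f.ker ≠ ⊤ := by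
    intro h
    have : Fact (1 < p ^ e) := ⟨Nat.one_lt_pow he hp.one_lt⟩
    obtain ⟨a, b, hab⟩ := exists_pair_ne (Multiplicative (ZMod (p ^ e)))
    have h1 : ∀ c : Multiplicative (ZMod (p ^ e)), c = 1 := fun c => by
      rw [← hfs' c, ← MonoidHom.mem_ker, h]; exact Subgroup.mem_top _
    exact hab ((h1 a).trans (h1 b).symm)
  have hlt : Nat.card f.ker < n := hn ▸ lt_of_not_ge fun h =>
    hker (Subgroup.eq_top_of_le_card _ h)
  obtain ⟨i, hi⟩ := exists_forall_eq_zsmul_of_prime_pow hp fun i => (f (x i)).toAdd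
  choose k hk using hi
  have hk' : ∀ j, f (x j) = f (x i) ^ k j := fun j => Multiplicative.toAdd.injective (hk j)
  let y : {j // j ≠ i} → f.ker := fun j => ⟨x j * (x i ^ k j)⁻¹, by
    rw [MonoidHom.mem_ker, map_mul, map_inv, map_zpow, hk' j, mul_inv_cancel]⟩
  obtain ⟨S, hS, hle⟩ := ih _ hlt rfl y fun j hj => by
    apply hx j
    have hmem : (y j : G) ∈ Subgroup.closure (x '' {l | l ≠ j}) := by
      have h1 : (y j : G) ∈ (Subgroup.closure (y '' {l | l ≠ j})).map f.ker.subtype := ⟨_, hj, rfl⟩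
      rw [MonoidHom.map_closure] at h1
      refine (Subgroup.closure_le _).2 ?_ h1
      rintro _ ⟨_, ⟨l, hl, rfl⟩, rfl⟩
      exact mul_mem (Subgroup.subset_closure ⟨l, fun h => hl (Subtype.ext h), rfl⟩)
        (inv_mem (zpow_mem (Subgroup.subset_closure (Set.mem_image_of_mem x j.2.symm)) _))
    have h2 : x j = y j * x i ^ k j := by simp [y]
    rw [h2]
    exact mul_mem hmem (zpow_mem (Subgroup.subset_closure (Set.mem_image_of_mem x j.2.symm)) _)
  obtain ⟨T, hT, hST⟩ := hS.exists_of_complement hdisj hsup hker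
  exact ⟨T, hT, (natCard_eq_natCard_ne_add_one i).trans_le ((Nat.succ_le_succ hle).trans hST)⟩

/-- Let `M` complement an abelian normal subgroup `N` centralized by the commutator subgroup.
Then a maximal subgroup `L` meets `M` in a maximal subgroup or in one containing `⁅M, M⁆`. -/
theorem isCoatom_subgroupOf_or_commutator_le {G : Type*} [Group G] {N M L : Subgroup G} [N.Normal]
    (hN : N ≤ Subgroup.centralizer N) (hNG : N ≤ Subgroup.centralizer (commutator G))
    (hdisj : N ⊓ M = ⊥) (hsup : N ⊔ M = ⊤) (hL : IsCoatom L) :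
    IsCoatom (L.subgroupOf M) ∨ commutator M ≤ L.subgroupOf M := by
  set K : Subgroup G := ⁅M, M⁆
  by_cases hKL : K ≤ L
  · right
    rwa [Subgroup.subgroupOf, ← Subgroup.map_le_iff_le_comap, Subgroup.map_subtype_commutator]
  left
  have hKM : K ≤ M := Subgroup.commutator_le_self M
  have hML : ¬ M ≤ L := fun h => hKL (hKM.trans h)
  refine ⟨fun h => hML (Subgroup.subgroupOf_eq_top.1 h), fun Q hQ => ?_⟩
  obtain ⟨q, hqQ, hqL⟩ := SetLike.exists_of_lt hQ
  rw [Subgroup.mem_subgroupOf] at hqL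
  have hPQ : ∀ m ∈ M, m ∈ L → m ∈ Q.map M.subtype := fun m hm hmL =>
    ⟨⟨m, hm⟩, hQ.le (Subgroup.mem_subgroupOf.2 hmL), rfl⟩
  have hqQ' : (q : G) ∈ Q.map M.subtype := ⟨q, hqQ, rfl⟩
  have hQM : Q.map M.subtype ≤ M := Subgroup.map_subtype_le Q
  suffices h : M ≤ Q.map M.subtype by
    rw [eq_top_iff]
    intro m _
    obtain ⟨m', hm', he⟩ := h m.2
    exact (Subtype.ext he : m' = m) ▸ hm'
  set R : Subgroup G := Q.map M.subtype
  have hdec : ∀ g : G, ∃ a ∈ N, ∃ m ∈ M, a * m = g := fun g =>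
    Subgroup.mem_sup_of_normal_left.1 (hsup ▸ Subgroup.mem_top g)
  intro m hm
  by_cases hNL : N ≤ L
  · have hlt : L < N ⊔ R := by
      refine lt_of_le_of_ne (fun l hl => ?_) fun h => hqL (h ▸ Subgroup.mem_sup_right hqQ')
      obtain ⟨a, ha, b, hb, rfl⟩ := hdec l
      exact Subgroup.mul_mem_sup ha (hPQ b hb ((Subgroup.mul_mem_cancel_left L (hNL ha)).1 hl))
    obtain ⟨a, ha, b, hb, rfl⟩ := Subgroup.mem_sup_of_normal_left.1
      (hL.2 _ hlt ▸ Subgroup.mem_top m)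
    have : a ∈ N ⊓ M := ⟨ha, (Subgroup.mul_mem_cancel_right M (hQM hb)).1 hm⟩
    rw [hdisj, Subgroup.mem_bot] at this
    rwa [this, one_mul]
  have htop : ∀ H : Subgroup G, ¬ H ≤ L → H ⊔ L = ⊤ := fun H hH =>
    hL.2 _ (lt_of_le_of_ne le_sup_right fun h => hH (h ▸ le_sup_left))
  have hKG : K ≤ commutator G := Subgroup.commutator_mono le_top le_top
  have hnormal : ∀ S : Subgroup G, S ≤ K → (∀ m ∈ M, ∀ s ∈ S, m * s * m⁻¹ ∈ S) → S.Normal := by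
    refine fun S hS h => ⟨fun s hs g => ?_⟩
    obtain ⟨a, ha, b, hb, rfl⟩ := hdec g
    have h1 := h b hb s hs
    have h2 := Subgroup.mem_centralizer_iff.1 (hNG ha) _ (hKG (hS h1))
    have h3 : a * b * s * (a * b)⁻¹ = b * s * b⁻¹ := by
      calc a * b * s * (a * b)⁻¹ = a * (b * s * b⁻¹) * a⁻¹ := by group
        _ = b * s * b⁻¹ := by rw [← h2]; group
    rwa [h3]
  have hKnormal : K.Normal := hnormal K le_rfl fun m hm s hs => by
    have h1 : ⁅m, s⁆ ∈ K := Subgroup.commutator_mem_commutator hm (hKM hs)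
    have h2 : m * s * m⁻¹ = ⁅m, s⁆ * s := by rw [commutatorElement_def]; group
    rw [h2]
    exact mul_mem h1 hs
  have hKdec : ∀ g : G, ∃ k ∈ K, ∃ l ∈ L, k * l = g := fun g =>
    Subgroup.mem_sup_of_normal_left.1 (htop K hKL ▸ Subgroup.mem_top g)
  have hNdec : ∀ g : G, ∃ a ∈ N, a * g ∈ L := fun g => by
    obtain ⟨a, ha, l, hl, rfl⟩ := Subgroup.mem_sup_of_normal_left.1
      (htop N hNL ▸ Subgroup.mem_top g)
    exact ⟨a⁻¹, inv_mem ha, by rwa [inv_mul_cancel_left]⟩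
  have hKK : ∀ k₁ ∈ K, ∀ k₂ ∈ K, ⁅k₁, k₂⁆ ∈ L := by
    intro k₁ hk₁ k₂ hk₂
    obtain ⟨a, ha, hal⟩ := hNdec k₁
    obtain ⟨b, hb, hbl⟩ := hNdec k₂
    have hab : Commute b a := Subgroup.mem_centralizer_iff.1 (hN ha) _ hb
    have c1 : ∀ c ∈ N, ∀ k ∈ K, Commute k c := fun c hc k hk =>
      Subgroup.mem_centralizer_iff.1 (hNG hc) _ (hKG hk)
    have key : ⁅a * k₁, b * k₂⁆ = ⁅k₁, k₂⁆ := by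
      have e1 : a * k₁ * (b * k₂) = a * b * (k₁ * k₂) := by
        rw [mul_assoc, ← mul_assoc k₁, (c1 b hb k₁ hk₁).eq]; group
      have e2 : b * k₂ * (a * k₁) = a * b * (k₂ * k₁) := by
        rw [mul_assoc, ← mul_assoc k₂, (c1 a ha k₂ hk₂).eq, ← hab.eq]; group
      have e3 : ∀ u v : G, ⁅u, v⁆ = u * v * (v * u)⁻¹ := fun u v => by
        rw [commutatorElement_def]; group
      have e4 : Commute (k₁ * k₂ * (k₂ * k₁)⁻¹) (a * b) :=
        c1 _ (mul_mem ha hb) _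
          (mul_mem (mul_mem hk₁ hk₂) (inv_mem (mul_mem hk₂ hk₁)))
      rw [e3, e3, e1, e2, mul_inv_rev, ← mul_assoc, mul_assoc (a * b), ← e4.eq,
        mul_inv_cancel_right]
    rw [← key, commutatorElement_def]
    exact mul_mem (mul_mem (mul_mem hal hbl) (inv_mem hal)) (inv_mem hbl)
  have hSnormal : (R ⊓ K).Normal := by
    refine hnormal _ inf_le_right fun m hm s hs => ?_
    obtain ⟨k, hk, l, hl, rfl⟩ := hKdec m
    have hlR : l ∈ R := hPQ l ((Subgroup.mul_mem_cancel_left M (hKM hk)).1 hm) hl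
    have hsl : l * s * l⁻¹ ∈ R ⊓ K :=
      ⟨mul_mem (mul_mem hlR hs.1) (R.inv_mem hlR), hKnormal.conj_mem s hs.2 l⟩
    have hcK : ⁅k, l * s * l⁻¹⁆ ∈ K := by
      rw [commutatorElement_def]
      exact mul_mem (mul_mem (mul_mem hk hsl.2) (inv_mem hk)) (inv_mem hsl.2)
    have hc : ⁅k, l * s * l⁻¹⁆ ∈ R ⊓ K := ⟨hPQ _ (hKM hcK) (hKK k hk _ hsl.2), hcK⟩
    have he : k * l * s * (k * l)⁻¹ = ⁅k, l * s * l⁻¹⁆ * (l * s * l⁻¹) := by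
      rw [commutatorElement_def]; group
    rw [he]
    exact mul_mem hc hsl
  have hSL : ¬ R ⊓ K ≤ L := by
    intro h
    obtain ⟨k, hk, l, hl, he⟩ := hKdec q
    have hlM : l ∈ M := (Subgroup.mul_mem_cancel_left M (hKM hk)).1 (he ▸ q.2)
    have hkR : k ∈ R := (Subgroup.mul_mem_cancel_right R (hPQ l hlM hl)).1 (he ▸ hqQ')
    exact hqL (he ▸ mul_mem (h ⟨hkR, hk⟩) hl)
  obtain ⟨s, hs, l, hl, rfl⟩ := Subgroup.mem_sup_of_normal_left.1
    (htop _ hSL ▸ Subgroup.mem_top m)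
  exact mul_mem hs.1 (hPQ l ((Subgroup.mul_mem_cancel_left M (hQM hs.1)).1 hm) hl)

/-- Let `G` be a finite group with nilpotent commutator subgroup, and let `D i` be subgroups in
general position, each maximal or containing the commutator subgroup. Then some irredundant
generating set of `G` is at least as large as the family. -/
theorem exists_isIrredundantGenSet_of_generalPosition {n : ℕ} {G : Type*} [Group G] [Finite G]
    (hn : Nat.card G = n) (hG : Group.IsNilpotent (commutator G)) {ι : Type*} [Finite ι]
    (D : ι → Subgroup G) (hD : ∀ i, IsCoatom (D i) ∨ commutator G ≤ D i) (x : ι → G)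
    (hx : ∀ i, x i ∉ D i) (hxD : ∀ i j, j ≠ i → x i ∈ D j) :
    ∃ S : Set G, IsIrredundantGenSet S ∧ Nat.card ι ≤ S.ncard := by
  induction n using Nat.strong_induction_on generalizing G ι with
  | _ n ih =>
  by_cases hbot : commutator G = ⊥
  · have := (commutator_eq_bot_iff G).1 hbot
    let _ : CommGroup G := { ‹Group G› with mul_comm := fun a b => mul_comm' a b }
    refine exists_isIrredundantGenSet_of_commGroup hn x fun i hi => hx i ?_
    refine (Subgroup.closure_le _).2 ?_ hi
    rintro _ ⟨j, hj, rfl⟩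
    exact hxD j i (Ne.symm hj)
  let Z : Subgroup G := (Subgroup.center (commutator G)).map (commutator G).subtype
  have hZbot : Z ≠ ⊥ := by
    have : Nontrivial (commutator G) := (Subgroup.nontrivial_iff_ne_bot _).2 hbot
    rw [Ne, Subgroup.map_eq_bot_iff_of_injective _ (Subgroup.subtype_injective _)]
    exact Group.IsNilpotent.center_ne_bot _
  have hZle : Z ≤ commutator G := Subgroup.map_subtype_le _
  have hZcent : Z ≤ Subgroup.centralizer (commutator G) := by
    rintro _ ⟨z, hz, rfl⟩
    exact Subgroup.mem_centralizer_iff.2 fun g hg =>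
      congrArg Subtype.val (Subgroup.mem_center_iff.1 hz ⟨g, hg⟩)
  have hZnormal : Z.Normal := inferInstance
  obtain ⟨N, hNZ, hN⟩ := exists_minimal_le_of_wellFoundedLT
    (fun N : Subgroup G => N.Normal ∧ N ≠ ⊥) Z ⟨hZnormal, hZbot⟩
  have hNnormal : N.Normal := hN.prop.1
  have hNG : N ≤ commutator G := hNZ.trans hZle
  have hNcent : N ≤ Subgroup.centralizer (commutator G) := hNZ.trans hZcent
  have hNN : N ≤ Subgroup.centralizer N := hNcent.trans (Subgroup.centralizer_le hNG)
  by_cases hall : ∀ i, N ≤ D i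
  · let π := QuotientGroup.mk' N
    have hπ : Function.Surjective π := QuotientGroup.mk'_surjective N
    have hcomap : ∀ i, ((D i).map π).comap π = D i := fun i =>
      Subgroup.comap_map_eq_self ((QuotientGroup.ker_mk' N).trans_le (hall i))
    have hcomm : (commutator G).map π = commutator (G ⧸ N) := by
      rw [commutator_def, commutator_def, Subgroup.map_commutator,
        Subgroup.map_top_of_surjective _ hπ]
    have hlt : Nat.card (G ⧸ N) < n := by
      rw [← hn, N.card_eq_card_quotient_mul_card_subgroup]
      exact lt_mul_of_one_lt_right Nat.card_pos (N.one_lt_card_iff_ne_bot.2 hN.prop.2)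
    have hnil : Group.IsNilpotent (commutator (G ⧸ N)) := by
      rw [← hcomm]
      exact Group.nilpotent_of_surjective _ (π.subgroupMap_surjective (commutator G))
    have hDπ : ∀ i, IsCoatom ((D i).map π) ∨ commutator (G ⧸ N) ≤ (D i).map π := by
      intro i
      refine (hD i).imp (fun h => ?_) fun h => hcomm ▸ Subgroup.map_mono h
      refine ⟨fun htop => h.1 ?_, fun Q hQ => ?_⟩
      · rw [← hcomap i, htop, Subgroup.comap_top]
      · refine Subgroup.comap_injective hπ ?_
        rw [Subgroup.comap_top]
        refine h.2 _ (hcomap i ▸ ?_)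
        exact (Subgroup.comap_lt_comap_of_surjective hπ).2 hQ
    obtain ⟨S, hS, hle⟩ := ih _ hlt rfl hnil (fun i => (D i).map π) hDπ (fun i => π (x i))
      (fun i hi => hx i (hcomap i ▸ hi)) fun i j hij => Subgroup.mem_map_of_mem π (hxD i j hij)
    obtain ⟨T, hT, hST, -⟩ := hS.exists_lift π ⊤ (Subgroup.map_top_of_surjective _ hπ)
    exact ⟨T, hT, hle.trans hST⟩
  push Not at hall
  obtain ⟨i, hi⟩ := hall
  have hM : IsCoatom (D i) := (hD i).resolve_right fun h => hi (hNG.trans h)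
  have hsup : N ⊔ D i = ⊤ := hM.2 _ (lt_of_le_of_ne le_sup_right fun h => hi (h ▸ le_sup_left))
  have hdisj : N ⊓ D i = ⊥ := by
    by_contra hne
    refine hi (inf_eq_left.1 (hN.eq_of_le ⟨⟨fun a ha g => ?_⟩, hne⟩ inf_le_left))
    refine ⟨hNnormal.conj_mem a ha.1 g, ?_⟩
    obtain ⟨b, hb, m, hm, rfl⟩ := Subgroup.mem_sup_of_normal_left.1 (hsup ▸ Subgroup.mem_top g)
    have hconj : m * a * m⁻¹ ∈ D i := mul_mem (mul_mem hm ha.2) (inv_mem hm)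
    have hc := Subgroup.mem_centralizer_iff.1 (hNN hb) _ (hNnormal.conj_mem a ha.1 m)
    have he : b * m * a * (b * m)⁻¹ = m * a * m⁻¹ := by
      calc b * m * a * (b * m)⁻¹ = b * (m * a * m⁻¹) * b⁻¹ := by group
        _ = m * a * m⁻¹ := by rw [← hc]; group
    rwa [he]
  have hlt : Nat.card (D i) < n := hn ▸ lt_of_not_ge fun h =>
    hM.1 (Subgroup.eq_top_of_le_card _ h)
  have hcomm : (commutator (D i)).map (D i).subtype ≤ commutator G := by
    rw [Subgroup.map_subtype_commutator]
    exact Subgroup.commutator_mono le_top le_top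
  have hnil : Group.IsNilpotent (commutator (D i)) := by
    let f : commutator (D i) →* commutator G :=
      ((D i).subtype.comp (commutator (D i)).subtype).codRestrict _
        fun g => hcomm (Subgroup.mem_map_of_mem _ g.2)
    refine Subgroup.isNilpotent_of_ker_le_center f fun g hg => ?_
    have h1 : (((g : D i) : G)) = 1 := congrArg Subtype.val (MonoidHom.mem_ker.1 hg)
    rw [show g = 1 from Subtype.ext (Subtype.ext h1)]
    exact one_mem _
  have hDM : ∀ j : {j // j ≠ i}, IsCoatom ((D j).subgroupOf (D i)) ∨
      commutator (D i) ≤ (D j).subgroupOf (D i) := by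
    intro j
    rcases hD j with h | h
    · exact isCoatom_subgroupOf_or_commutator_le hNN hNcent hdisj hsup h
    · exact Or.inr (Subgroup.map_le_iff_le_comap.1 (hcomm.trans h))
  obtain ⟨S, hS, hle⟩ := ih _ hlt rfl hnil (fun j : {j // j ≠ i} => (D j).subgroupOf (D i))
    hDM (fun j => ⟨x j, hxD j i j.2.symm⟩) (fun j => hx j)
    fun j k hkj => hxD j k fun h => hkj (Subtype.ext h)
  obtain ⟨T, hT, hST⟩ := hS.exists_of_complement hdisj hsup hM.1
  exact ⟨T, hT, (natCard_eq_natCard_ne_add_one i).trans_le ((Nat.succ_le_succ hle).trans hST)⟩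

theorem IsIrredundantGenSet.exists_irredundant {G : Type*} [Group G] [Finite G] {S : Set G}
    (hS : IsIrredundantGenSet S) : ∃ g : Fin S.ncard → G,
      Irredundant g ∧ Subgroup.closure (Set.range g) = ⊤ := by
  let e : Fin S.ncard ≃ S := (Finite.equivFin S).symm
  have hrange : Set.range (fun i => (e i : G)) = S := by
    rw [← Function.comp_def, e.surjective.range_comp, Subtype.range_coe]
  refine ⟨fun i => e i, fun i => ?_, by rw [hrange, hS.1]⟩
  rw [hrange, hS.1, lt_top_iff_ne_top]
  intro h
  have h1 : (e i : G) ∈ Subgroup.closure ((fun i => (e i : G)) '' {j | j ≠ i}) :=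
    h ▸ Subgroup.mem_top _
  refine hS.2 (e i) (e i).2 (Subgroup.closure_mono ?_ h1)
  rintro _ ⟨j, hj, rfl⟩
  exact ⟨(e j).2, fun h => hj (e.injective (Subtype.ext h))⟩

theorem Irredundant.injective {G : Type*} [Group G] {n : ℕ} {g : Fin n → G}
    (hg : Irredundant g) : Function.Injective g := by
  intro i j hij
  by_contra hne
  refine (hg i).not_ge ((Subgroup.closure_le _).2 ?_)
  rintro _ ⟨k, rfl⟩
  by_cases hk : k = i
  · exact Subgroup.subset_closure ⟨j, Ne.symm hne, by rw [hk, hij]⟩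
  · exact Subgroup.subset_closure ⟨k, hk, rfl⟩

/-- An irredundant generating sequence yields equally many maximal subgroups in general
position. -/
theorem Irredundant.exists_generalPosition {G : Type*} [Group G] [Finite G] {n : ℕ}
    {g : Fin n → G} (hg : Irredundant g) (htop : Subgroup.closure (Set.range g) = ⊤) :
    ∃ M : Fin n → Subgroup G, (∀ i, IsCoatom (M i)) ∧ GeneralPosition M := by
  have h1 : ∀ i, ∃ M, IsCoatom M ∧ Subgroup.closure (g '' {j | j ≠ i}) ≤ M := fun i =>
    (eq_top_or_exists_le_coatom _).resolve_left (htop ▸ hg i).ne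
  choose M hM hle using h1
  have hmem : ∀ i j, j ≠ i → g j ∈ M i := fun i j hj =>
    hle i (Subgroup.subset_closure (Set.mem_image_of_mem g hj))
  refine ⟨M, hM, fun i => lt_of_le_of_ne (le_iInf₂ fun j _ => iInf_le M j) fun h => ?_⟩
  have hgi : g i ∈ M i := by
    have h2 : g i ∈ ⨅ j ∈ ({i}ᶜ : Set (Fin n)), M j :=
      Subgroup.mem_iInf.2 fun j => Subgroup.mem_iInf.2 fun hj => hmem j i (Ne.symm hj)
    rw [← h] at h2
    exact Subgroup.mem_iInf.1 h2 i
  refine (hM i).1 (top_unique (htop.ge.trans ((Subgroup.closure_le _).2 ?_)))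
  rintro _ ⟨j, rfl⟩
  by_cases hj : j = i
  · exact hj ▸ hgi
  · exact hmem i j hj

/-- If `G` is a finite group whose derived subgroup is nilpotent, then `md(G) = m(G)`. -/
theorem md_eq_m_of_commutator_nilpotent (G : Type*) [Group G] [Finite G]
    (h : Group.IsNilpotent ↥(commutator G)) : mdInv G = mInv G := by
  have hbdd : BddAbove {n | ∃ g : Fin n → G, Irredundant g ∧
      Subgroup.closure (Set.range g) = ⊤} := by
    refine ⟨Nat.card G, ?_⟩
    rintro n ⟨g, hg, -⟩
    simpa using Nat.card_le_card_of_injective g hg.injective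
  have hle : ∀ n ∈ {n | ∃ M : Fin n → Subgroup G, (∀ i, IsCoatom (M i)) ∧ GeneralPosition M},
      n ≤ mInv G := by
    rintro n ⟨M, hM, hgp⟩
    have h1 : ∀ i, ∃ y, y ∉ M i ∧ ∀ j, j ≠ i → y ∈ M j := fun i => by
      obtain ⟨y, hy, hyn⟩ := SetLike.exists_of_lt (hgp i)
      have hyj : ∀ j, j ≠ i → y ∈ M j := fun j hj =>
        Subgroup.mem_iInf.1 (Subgroup.mem_iInf.1 hy j) hj
      refine ⟨y, fun hyi => hyn (Subgroup.mem_iInf.2 fun j => ?_), hyj⟩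
      by_cases hj : j = i
      · exact hj ▸ hyi
      · exact hyj j hj
    choose y hy hyM using h1
    obtain ⟨S, hS, hcard⟩ := exists_isIrredundantGenSet_of_generalPosition rfl h M
      (fun i => Or.inl (hM i)) y hy hyM
    rw [Nat.card_fin] at hcard
    exact hcard.trans (le_csSup hbdd hS.exists_irredundant)
  refine le_antisymm (csSup_le' fun n hn => hle n hn) (csSup_le' ?_)
  rintro n ⟨g, hg, htop⟩
  exact le_csSup ⟨_, hle⟩ (hg.exists_generalPosition htop)
end

section
/- For any odd prime p, there exists a finite group G of Fitting length 2 (that is, G has a nilpotent normal subgroup N with G/N nilpotent, and G is not itself nilpotent) such that m(G) = 3, md(G) = p, and i(G) = 2p. -/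
/-- `iInv G` is the maximum size of an irredundant sequence of elements of `G`. -/
noncomputable def iInv (G : Type*) [Group G] : ℕ :=
  sSup {n | ∃ g : Fin n → G, Irredundant g}

section General

variable {G : Type*} [Group G]

theorem irredundant_of_separating {n : ℕ} {g : Fin n → G}
    (h : ∀ i, ∃ L : Subgroup G, (∀ j, j ≠ i → g j ∈ L) ∧ g i ∉ L) : Irredundant g := by
  intro i
  obtain ⟨L, hL, hi⟩ := h i
  refine lt_of_le_of_ne (Subgroup.closure_mono (Set.image_subset_range _ _)) fun he => hi ?_
  have hle : Subgroup.closure (g '' {j | j ≠ i}) ≤ L := by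
    rw [Subgroup.closure_le]
    rintro _ ⟨j, hj, rfl⟩
    exact hL j hj
  exact hle (he ▸ Subgroup.subset_closure ⟨i, rfl⟩)

theorem Irredundant.notMem {n : ℕ} {g : Fin n → G} (h : Irredundant g) (i : Fin n) :
    g i ∉ Subgroup.closure (g '' {j | j ≠ i}) := by
  intro hi
  refine (h i).not_ge ?_
  rw [Subgroup.closure_le]
  rintro _ ⟨j, rfl⟩
  by_cases hj : j = i
  · exact hj ▸ hi
  · exact Subgroup.subset_closure ⟨j, hj, rfl⟩

theorem generalPosition_iff {ι : Type*} {H : ι → Subgroup G} :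
    GeneralPosition H ↔ ∀ i, ∃ x, (∀ j, j ≠ i → x ∈ H j) ∧ x ∉ H i := by
  refine forall_congr' fun i => ?_
  have hle : (⨅ j, H j) ≤ ⨅ j ∈ ({i}ᶜ : Set ι), H j := le_iInf₂ fun j _ => iInf_le _ j
  rw [SetLike.lt_iff_le_and_exists, and_iff_right hle]
  refine exists_congr fun x => ?_
  simp only [Subgroup.mem_iInf, Set.mem_compl_iff, Set.mem_singleton_iff]
  refine and_congr_right fun h => not_congr ⟨fun h' => h' i, fun h' j => ?_⟩
  by_cases hj : j = i
  · exact hj ▸ h'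
  · exact h j hj

theorem cardFactors_card_lt_of_lt [Finite G] {H K : Subgroup G} (h : H < K) :
    ArithmeticFunction.cardFactors (Nat.card H) < ArithmeticFunction.cardFactors (Nat.card K) := by
  obtain ⟨m, hm⟩ := Subgroup.card_dvd_of_le h.le
  have hK : Nat.card K ≠ 0 := Nat.card_pos.ne'
  have hm0 : m ≠ 0 := by rintro rfl; exact hK (by simpa using hm)
  have hm1 : m ≠ 1 := by
    rintro rfl
    exact h.ne (Subgroup.eq_of_le_of_card_ge h.le (by simp [hm]))
  rw [hm, ArithmeticFunction.cardFactors_mul Nat.card_pos.ne' hm0]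
  have : 0 < ArithmeticFunction.cardFactors m := by
    rw [Nat.pos_iff_ne_zero, Ne, ArithmeticFunction.cardFactors_eq_zero_iff_eq_zero_or_one]
    tauto
  omega

/-- An independent family has at most as many members as the order of the subgroup it generates
has prime factors, counted with multiplicity. -/
theorem card_le_cardFactors_card_closure [Finite G] {ι : Type*} (s : Finset ι) (g : ι → G)
    (h : ∀ i ∈ s, g i ∉ Subgroup.closure (g '' {j | j ∈ s ∧ j ≠ i})) :
    s.card ≤ ArithmeticFunction.cardFactors (Nat.card (Subgroup.closure (g '' s))) := by
  classical
  induction s using Finset.induction_on with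
  | empty => simp
  | insert a s ha ih =>
    have ih' := ih fun i hi hmem => by
      refine h i (Finset.mem_insert_of_mem hi) (Subgroup.closure_mono (Set.image_mono ?_) hmem)
      exact fun j hj => ⟨Finset.mem_insert_of_mem hj.1, hj.2⟩
    have hlt : Subgroup.closure (g '' s) < Subgroup.closure (g '' (insert a s : Finset ι)) := by
      refine lt_of_le_of_ne (Subgroup.closure_mono (Set.image_mono (by simp))) fun he => ?_
      have hmem : g a ∈ Subgroup.closure (g '' (insert a s : Finset ι)) :=
        Subgroup.subset_closure ⟨a, by simp, rfl⟩
      rw [← he] at hmem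
      refine h a (Finset.mem_insert_self _ _) (Subgroup.closure_mono (Set.image_mono ?_) hmem)
      intro j hj
      exact ⟨Finset.mem_insert_of_mem hj, fun e => ha (e ▸ hj)⟩
    have := cardFactors_card_lt_of_lt hlt
    rw [Finset.card_insert_of_notMem ha]
    omega

theorem Irredundant.le_cardFactors [Finite G] {n : ℕ} {g : Fin n → G} (h : Irredundant g) :
    n ≤ ArithmeticFunction.cardFactors (Nat.card (Subgroup.closure (Set.range g))) := by
  simpa using card_le_cardFactors_card_closure Finset.univ g fun i _ => by simpa using h.notMem i

theorem card_le_cardFactors_card [Finite G] {ι : Type*} (s : Finset ι) (g : ι → G)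
    (h : ∀ i ∈ s, g i ∉ Subgroup.closure (g '' {j | j ∈ s ∧ j ≠ i})) :
    s.card ≤ ArithmeticFunction.cardFactors (Nat.card G) := by
  refine (card_le_cardFactors_card_closure s g h).trans ?_
  rcases eq_or_lt_of_le (le_top : Subgroup.closure (g '' s) ≤ ⊤) with he | hlt
  · rw [he]; simp
  · simpa using (cardFactors_card_lt_of_lt hlt).le

theorem exists_finset_closure_image_eq [Finite G] {ι : Type*} (g : ι → G) (s : Finset ι) :
    ∃ t ⊆ s, Subgroup.closure (g '' t) = Subgroup.closure (g '' s) ∧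
      t.card ≤ ArithmeticFunction.cardFactors (Nat.card G) := by
  classical
  induction s using Finset.strongInduction with
  | H s ih =>
    by_cases h : ∀ i ∈ s, g i ∉ Subgroup.closure (g '' {j | j ∈ s ∧ j ≠ i})
    · exact ⟨s, subset_rfl, rfl, card_le_cardFactors_card s g h⟩
    · push Not at h
      obtain ⟨i, hi, hmem⟩ := h
      obtain ⟨t, hts, ht, hc⟩ := ih (s.erase i) (Finset.erase_ssubset hi)
      refine ⟨t, hts.trans (Finset.erase_subset _ _), ?_, hc⟩
      rw [ht]
      refine le_antisymm (Subgroup.closure_mono (Set.image_mono (by simp))) ?_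
      rw [Subgroup.closure_le]
      rintro _ ⟨j, hj, rfl⟩
      by_cases hji : j = i
      · subst hji
        exact Subgroup.closure_mono (Set.image_mono fun k hk => by simp [hk.1, hk.2]) hmem
      · exact Subgroup.subset_closure ⟨j, by simp [hji, Finset.mem_coe.1 hj], rfl⟩

theorem normal_of_isCoatom_of_le {V M : Subgroup G} [V.Normal]
    [Group.IsNilpotent (G ⧸ V)] (hM : IsCoatom M) (hVM : V ≤ M) : M.Normal := by
  have hcm : (M.map (QuotientGroup.mk' V)).comap (QuotientGroup.mk' V) = M := by
    rw [Subgroup.comap_map_eq, QuotientGroup.ker_mk', sup_eq_left.2 hVM]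
  have hco : IsCoatom (M.map (QuotientGroup.mk' V)) := by
    refine ⟨fun h => hM.1 (by rw [← hcm, h, Subgroup.comap_top]), fun L hL => ?_⟩
    have hs := QuotientGroup.mk'_surjective V
    have : L.comap (QuotientGroup.mk' V) = ⊤ := by
      refine hM.2 _ ?_
      rw [← hcm]
      exact (Subgroup.comap_lt_comap_of_surjective hs).2 hL
    rw [← Subgroup.map_comap_eq_self_of_surjective hs L, this, Subgroup.map_top_of_surjective _ hs]
  have := Subgroup.NormalizerCondition.normal_of_coatom _
    (Group.normalizerCondition_of_isNilpotent (G := G ⧸ V)) hco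
  rw [← hcm]
  infer_instance

theorem commutatorElement_mem_of_isCoatom {M : Subgroup G} [M.Normal] (hM : IsCoatom M) (x y : G) :
    x * y * x⁻¹ * y⁻¹ ∈ M := by
  obtain ⟨g, -, hg⟩ := SetLike.exists_of_lt (lt_top_iff_ne_top.2 hM.1)
  have hsup : M ⊔ Subgroup.zpowers g = ⊤ :=
    hM.2 _ (lt_of_le_of_ne le_sup_left fun h =>
      hg (h ▸ (le_sup_right : Subgroup.zpowers g ≤ _) (Subgroup.mem_zpowers g)))
  have := Subgroup.Normal.commutator_le_of_self_sup_commutative_eq_top hsup inferInstance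
  exact this (Subgroup.commutator_mem_commutator (Subgroup.mem_top x) (Subgroup.mem_top y))

end General

/-- The semidirect product `𝔽_r ^ p ⋊ (C_p ≀ C_p)`, in which the base group of the wreath product
acts on each coordinate through the character `χ` and the top group shifts the coordinates. -/
@[ext]
structure AffineWreath {p r : ℕ} (χ : AddChar (ZMod p) (ZMod r)) where
  /-- The translation part. -/
  trans : ZMod p → ZMod r
  /-- The exponents of the diagonal part. -/
  diag : ZMod p → ZMod p
  /-- The shift part. -/
  shift : ZMod p

namespace AffineWreath

variable {p r : ℕ} {χ : AddChar (ZMod p) (ZMod r)}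

instance : Mul (AffineWreath χ) :=
  ⟨fun g h => ⟨fun i => g.trans i + χ (g.diag i) * h.trans (i - g.shift),
    fun i => g.diag i + h.diag (i - g.shift), g.shift + h.shift⟩⟩

instance : One (AffineWreath χ) := ⟨⟨0, 0, 0⟩⟩

instance : Inv (AffineWreath χ) :=
  ⟨fun g => ⟨fun i => -(χ (-g.diag (i + g.shift)) * g.trans (i + g.shift)),
    fun i => -g.diag (i + g.shift), -g.shift⟩⟩

@[simp] theorem trans_mul (g h : AffineWreath χ) (i : ZMod p) :
    (g * h).trans i = g.trans i + χ (g.diag i) * h.trans (i - g.shift) := rfl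

@[simp] theorem diag_mul (g h : AffineWreath χ) (i : ZMod p) :
    (g * h).diag i = g.diag i + h.diag (i - g.shift) := rfl

@[simp] theorem shift_mul (g h : AffineWreath χ) : (g * h).shift = g.shift + h.shift := rfl

@[simp] theorem trans_one : (1 : AffineWreath χ).trans = 0 := rfl

@[simp] theorem diag_one : (1 : AffineWreath χ).diag = 0 := rfl

@[simp] theorem shift_one : (1 : AffineWreath χ).shift = 0 := rfl

@[simp] theorem trans_inv (g : AffineWreath χ) (i : ZMod p) :
    g⁻¹.trans i = -(χ (-g.diag (i + g.shift)) * g.trans (i + g.shift)) := rfl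

@[simp] theorem diag_inv (g : AffineWreath χ) (i : ZMod p) :
    g⁻¹.diag i = -g.diag (i + g.shift) := rfl

@[simp] theorem shift_inv (g : AffineWreath χ) : g⁻¹.shift = -g.shift := rfl

instance : Group (AffineWreath χ) :=
  Group.ofLeftAxioms
    (fun a b c => by
      ext i <;> simp [AddChar.map_add_eq_mul, sub_sub] <;> ring)
    (fun a => by ext i <;> simp)
    (fun a => by ext i <;> simp)

instance : MulAction (AffineWreath χ) (ZMod p → ZMod r) where
  smul g x i := g.trans i + χ (g.diag i) * x (i - g.shift)
  one_smul x := by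
    funext i
    change (0 : ZMod r) + χ 0 * x (i - 0) = x i
    simp
  mul_smul g h x := by
    funext i
    change (g * h).trans i + χ ((g * h).diag i) * x (i - (g * h).shift) =
      g.trans i + χ (g.diag i) * (h.trans (i - g.shift) + χ (h.diag (i - g.shift)) *
        x (i - g.shift - h.shift))
    simp only [trans_mul, diag_mul, shift_mul, AddChar.map_add_eq_mul, sub_sub]
    ring

theorem smul_apply (g : AffineWreath χ) (x : ZMod p → ZMod r) (i : ZMod p) :
    (g • x) i = g.trans i + χ (g.diag i) * x (i - g.shift) := rfl

/-- The underlying type of `AffineWreath χ` as a product. -/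
def equivProd : AffineWreath χ ≃ (ZMod p → ZMod r) × (ZMod p → ZMod p) × ZMod p where
  toFun g := (g.trans, g.diag, g.shift)
  invFun x := ⟨x.1, x.2.1, x.2.2⟩
  left_inv _ := rfl
  right_inv _ := rfl

instance [NeZero p] [NeZero r] : Finite (AffineWreath χ) := Finite.of_equiv _ equivProd.symm

theorem cardFactors_card [Fact p.Prime] [Fact r.Prime] :
    ArithmeticFunction.cardFactors (Nat.card (AffineWreath χ)) = 2 * p + 1 := by
  have hp : p.Prime := Fact.out
  have hr : r.Prime := Fact.out
  rw [Nat.card_congr equivProd, Nat.card_prod, Nat.card_prod, Nat.card_fun, Nat.card_fun,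
    Nat.card_zmod, Nat.card_zmod,
    ArithmeticFunction.cardFactors_mul (pow_ne_zero _ hr.ne_zero)
      (mul_ne_zero (pow_ne_zero _ hp.ne_zero) hp.ne_zero),
    ArithmeticFunction.cardFactors_mul (pow_ne_zero _ hp.ne_zero) hp.ne_zero,
    ArithmeticFunction.cardFactors_apply_prime_pow hr,
    ArithmeticFunction.cardFactors_apply_prime_pow hp,
    ArithmeticFunction.cardFactors_apply_prime hp]
  omega

/-- The homomorphism to the elementary abelian quotient of order `p ^ 2`: the sum of the
diagonal exponents and the shift. -/
def sumShift [NeZero p] : AffineWreath χ →* Multiplicative (ZMod p × ZMod p) where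
  toFun g := Multiplicative.ofAdd (∑ i, g.diag i, g.shift)
  map_one' := by simp
  map_mul' g h := by
    rw [← ofAdd_add, Prod.mk_add_mk]
    simp only [diag_mul, shift_mul, Finset.sum_add_distrib]
    have := Equiv.sum_comp (Equiv.subRight g.shift) h.diag
    simp only [Equiv.subRight_apply] at this
    rw [this]

theorem mem_ker_sumShift [NeZero p] {g : AffineWreath χ} :
    g ∈ (sumShift (χ := χ)).ker ↔ ∑ i, g.diag i = 0 ∧ g.shift = 0 := by
  simp [sumShift]

/-- The subgroup of translations. -/
def translations (χ : AddChar (ZMod p) (ZMod r)) : Subgroup (AffineWreath χ) where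
  carrier := {g | g.diag = 0 ∧ g.shift = 0}
  one_mem' := ⟨rfl, rfl⟩
  mul_mem' {a b} ha hb := by
    refine ⟨?_, by simp [ha.2, hb.2]⟩
    ext i
    simp [ha.1, hb.1]
  inv_mem' {a} ha := by
    refine ⟨?_, by simp [ha.2]⟩
    ext i
    simp [ha.1]

theorem mem_translations {g : AffineWreath χ} :
    g ∈ translations χ ↔ g.diag = 0 ∧ g.shift = 0 := Iff.rfl

instance : (translations χ).Normal where
  conj_mem n hn g := by
    obtain ⟨h1, h2⟩ := mem_translations.1 hn
    refine ⟨?_, by simp [h2]⟩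
    ext i
    simp [h1, h2]

/-- The translation by a vector. -/
def ofTrans (χ : AddChar (ZMod p) (ZMod r)) (v : ZMod p → ZMod r) : AffineWreath χ := ⟨v, 0, 0⟩

/-- The diagonal element with given exponents. -/
def ofDiag (χ : AddChar (ZMod p) (ZMod r)) (b : ZMod p → ZMod p) : AffineWreath χ := ⟨0, b, 0⟩

/-- The shift by a given amount. -/
def ofShift (χ : AddChar (ZMod p) (ZMod r)) (s : ZMod p) : AffineWreath χ := ⟨0, 0, s⟩

theorem ofTrans_add (v w : ZMod p → ZMod r) :
    ofTrans χ (v + w) = ofTrans χ v * ofTrans χ w := by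
  ext i <;> simp [ofTrans]

theorem ofTrans_neg (v : ZMod p → ZMod r) : ofTrans χ (-v) = (ofTrans χ v)⁻¹ := by
  ext i <;> simp [ofTrans]

theorem ofDiag_add (b c : ZMod p → ZMod p) :
    ofDiag χ (b + c) = ofDiag χ b * ofDiag χ c := by
  ext i <;> simp [ofDiag]

theorem ofDiag_neg (b : ZMod p → ZMod p) : ofDiag χ (-b) = (ofDiag χ b)⁻¹ := by
  ext i <;> simp [ofDiag]

theorem ofTrans_trans_mul_ofDiag_diag_mul_ofShift (g : AffineWreath χ) :
    ofTrans χ g.trans * ofDiag χ g.diag * ofShift χ g.shift = g := by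
  ext i <;> simp [ofTrans, ofDiag, ofShift]

theorem ofTrans_mem_translations (v : ZMod p → ZMod r) : ofTrans χ v ∈ translations χ :=
  ⟨rfl, rfl⟩

theorem ofTrans_trans_of_mem {g : AffineWreath χ} (hg : g ∈ translations χ) :
    ofTrans χ g.trans = g := by
  ext i <;> simp [ofTrans, hg.1, hg.2]

theorem conj_ofTrans (g : AffineWreath χ) (v : ZMod p → ZMod r) :
    g * ofTrans χ v * g⁻¹ = ofTrans χ fun i => χ (g.diag i) * v (i - g.shift) := by
  rw [mul_inv_eq_iff_eq_mul]
  ext i <;> simp [ofTrans, add_comm]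

/-- The vectors whose translations lie in a given subgroup. -/
def transVectors (K : Subgroup (AffineWreath χ)) : AddSubgroup (ZMod p → ZMod r) where
  carrier := {v | ofTrans χ v ∈ K}
  zero_mem' := K.one_mem
  add_mem' {v w} hv hw := by
    change ofTrans χ (v + w) ∈ K
    rw [ofTrans_add]
    exact K.mul_mem hv hw
  neg_mem' {v} hv := by
    change ofTrans χ (-v) ∈ K
    rw [ofTrans_neg]
    exact K.inv_mem hv

theorem mem_transVectors {K : Subgroup (AffineWreath χ)} {v : ZMod p → ZMod r} :
    v ∈ transVectors K ↔ ofTrans χ v ∈ K := Iff.rfl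

/-- The exponents whose diagonal elements lie in a given subgroup. -/
def diagExponents (K : Subgroup (AffineWreath χ)) : AddSubgroup (ZMod p → ZMod p) where
  carrier := {b | ofDiag χ b ∈ K}
  zero_mem' := K.one_mem
  add_mem' {v w} hv hw := by
    change ofDiag χ (v + w) ∈ K
    rw [ofDiag_add]
    exact K.mul_mem hv hw
  neg_mem' {v} hv := by
    change ofDiag χ (-v) ∈ K
    rw [ofDiag_neg]
    exact K.inv_mem hv

theorem mem_diagExponents {K : Subgroup (AffineWreath χ)} {b : ZMod p → ZMod p} :
    b ∈ diagExponents K ↔ ofDiag χ b ∈ K := Iff.rfl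

theorem exists_mem_of_sup_translations_eq_top {K : Subgroup (AffineWreath χ)}
    (h : K ⊔ translations χ = ⊤) (b : ZMod p → ZMod p) (s : ZMod p) :
    ∃ k ∈ K, k.diag = b ∧ k.shift = s := by
  have hmem : (⟨0, b, s⟩ : AffineWreath χ) ∈ K ⊔ translations χ := h ▸ Subgroup.mem_top _
  rw [← SetLike.mem_coe, Subgroup.mul_normal] at hmem
  obtain ⟨k, hk, t, ht, hkt⟩ := hmem
  obtain ⟨h1, h2⟩ := mem_translations.1 ht
  have hb := congrArg AffineWreath.diag hkt
  have hs := congrArg AffineWreath.shift hkt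
  refine ⟨k, hk, ?_, by simpa [h2] using hs⟩
  ext i
  simpa [h1] using congrFun hb i

theorem shift_pow (g : AffineWreath χ) (n : ℕ) : (g ^ n).shift = n * g.shift := by
  induction n with
  | zero => simp
  | succ n ih => rw [pow_succ, shift_mul, ih]; push_cast; ring

theorem diag_pow_of_shift_eq_zero {g : AffineWreath χ} (hg : g.shift = 0) (n : ℕ) (i : ZMod p) :
    (g ^ n).diag i = n * g.diag i := by
  induction n with
  | zero => simp
  | succ n ih => rw [pow_succ, diag_mul, ih, shift_pow, hg]; push_cast; ring_nf

theorem pow_mem_translations (g : AffineWreath χ) : g ^ p ^ 2 ∈ translations χ := by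
  have hs : (g ^ p).shift = 0 := by simp [shift_pow]
  rw [pow_two, pow_mul]
  refine ⟨?_, by simp [shift_pow]⟩
  ext i
  simp [diag_pow_of_shift_eq_zero hs]

theorem ofTrans_smul (v x : ZMod p → ZMod r) : ofTrans χ v • x = v + x := by
  funext i
  simp [smul_apply, ofTrans]

theorem stabilizer_sup_translations (x : ZMod p → ZMod r) :
    MulAction.stabilizer (AffineWreath χ) x ⊔ translations χ = ⊤ := by
  refine top_le_iff.1 fun g _ => ?_
  have hg : ofTrans χ (g • x - x) * ((ofTrans χ (g • x - x))⁻¹ * g) = g := mul_inv_cancel_left _ _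
  rw [← hg]
  refine mul_mem (Subgroup.mem_sup_right (ofTrans_mem_translations _)) (Subgroup.mem_sup_left ?_)
  rw [MulAction.mem_stabilizer_iff, mul_smul, inv_smul_eq_iff, ofTrans_smul, sub_add_cancel]

section Structure

variable [Fact p.Prime] [Fact r.Prime]

/-- The translation subgroup is an irreducible module. -/
theorem eq_top_of_inf_translations_ne_bot (hχ : ∀ a, χ a = 1 → a = 0)
    {K : Subgroup (AffineWreath χ)} (h : K ⊔ translations χ = ⊤)
    (hne : K ⊓ translations χ ≠ ⊥) : K = ⊤ := by
  have hstable : ∀ (b : ZMod p → ZMod p) (s : ZMod p), ∀ v ∈ transVectors K,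
      (fun i => χ (b i) * v (i - s)) ∈ transVectors K := by
    intro b s v hv
    obtain ⟨k, hk, rfl, rfl⟩ := exists_mem_of_sup_translations_eq_top h b s
    rw [mem_transVectors, ← conj_ofTrans]
    exact K.mul_mem (K.mul_mem hk hv) (K.inv_mem hk)
  obtain ⟨⟨g, hgK, hgV⟩, hg⟩ := Subgroup.ne_bot_iff_exists_ne_one.1 hne
  have hgv : g.trans ∈ transVectors K := by
    rw [mem_transVectors, ofTrans_trans_of_mem hgV]
    exact hgK
  obtain ⟨i, hi⟩ : ∃ i, g.trans i ≠ 0 := by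
    by_contra! hcon
    have h1 := ofTrans_trans_of_mem hgV
    rw [show g.trans = 0 from funext hcon] at h1
    exact hg (Subtype.ext h1.symm)
  have hc : (χ 1 - 1) * g.trans i ≠ 0 :=
    mul_ne_zero (sub_ne_zero.2 fun h1 => one_ne_zero (hχ 1 h1)) hi
  have hsingle : Pi.single i ((χ 1 - 1) * g.trans i) ∈ transVectors K := by
    convert sub_mem (hstable (Pi.single i 1) 0 _ hgv) hgv using 1
    funext j
    by_cases hj : j = i
    · subst hj; simp [sub_mul]
    · simp [hj]
  have hsingle' : ∀ a, Pi.single i a ∈ transVectors K := by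
    intro a
    convert nsmul_mem hsingle (a / ((χ 1 - 1) * g.trans i)).val using 1
    rw [← Pi.single_smul, nsmul_eq_mul, ZMod.natCast_zmod_val, div_mul_cancel₀ _ hc]
  have hall : ∀ v, v ∈ transVectors K := by
    intro v
    rw [← Finset.univ_sum_single v]
    refine sum_mem fun j _ => ?_
    convert hstable 0 (j - i) _ (hsingle' (v j)) using 1
    funext k
    by_cases hk : k = j
    · subst hk; simp
    · have : k - (j - i) ≠ i := fun e => hk (by linear_combination e)
      simp [hk, this]
  rw [← h, eq_comm, sup_eq_left]
  intro t ht
  rw [← ofTrans_trans_of_mem ht]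
  exact hall _

theorem isCoatom_of_sup_translations_eq_top (hχ : ∀ a, χ a = 1 → a = 0)
    {K : Subgroup (AffineWreath χ)} (h : K ⊔ translations χ = ⊤) (hK : K ≠ ⊤) : IsCoatom K := by
  refine ⟨hK, fun L hL => ?_⟩
  have hLV : L ⊔ translations χ = ⊤ := top_le_iff.1 (h ▸ sup_le_sup_right hL.le _)
  refine eq_top_of_inf_translations_ne_bot hχ hLV fun hbot => hL.not_ge fun l hl => ?_
  obtain ⟨k, hk, hd, hs⟩ := exists_mem_of_sup_translations_eq_top h l.diag l.shift
  have hmem : l * k⁻¹ ∈ L ⊓ translations χ := by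
    refine ⟨L.mul_mem hl (L.inv_mem (hL.le hk)), ?_⟩
    refine ⟨?_, by simp [hs]⟩
    ext i
    simp [hd, hs]
  rw [hbot, Subgroup.mem_bot, mul_inv_eq_one] at hmem
  exact hmem ▸ hk

instance : Group.IsNilpotent (AffineWreath χ ⧸ translations χ) := by
  refine IsPGroup.isNilpotent (p := p) fun x => ⟨2, ?_⟩
  obtain ⟨g, rfl⟩ := QuotientGroup.mk_surjective x
  rw [← QuotientGroup.mk_pow, QuotientGroup.eq_one_iff]
  exact pow_mem_translations g

instance : Group.IsNilpotent (translations χ) := by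
  have hc : ∀ a b : translations χ, a * b = b * a := by
    rintro ⟨a, ha⟩ ⟨b, hb⟩
    rw [Subtype.ext_iff]
    change a * b = b * a
    rw [← ofTrans_trans_of_mem ha, ← ofTrans_trans_of_mem hb, ← ofTrans_add, ← ofTrans_add,
      add_comm]
  let : CommGroup (translations χ) :=
    { (inferInstance : Group (translations χ)) with mul_comm := hc }
  exact CommGroup.isNilpotent

/-- A maximal subgroup containing the translations contains the kernel of `sumShift`. -/
theorem ker_sumShift_le_of_isCoatom {M : Subgroup (AffineWreath χ)} (hM : IsCoatom M)
    (hVM : translations χ ≤ M) : (sumShift (χ := χ)).ker ≤ M := by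
  have : M.Normal := normal_of_isCoatom_of_le hM hVM
  have hdiff : ∀ i a, Pi.single i a - Pi.single 0 a ∈ diagExponents M := by
    intro i a
    rw [mem_diagExponents]
    convert commutatorElement_mem_of_isCoatom hM (ofShift χ i) (ofDiag χ (Pi.single 0 a)) using 1
    rw [sub_eq_add_neg, ofDiag_add, ofDiag_neg]
    congr 1
    rw [eq_mul_inv_iff_mul_eq]
    ext k
    · simp [ofShift, ofDiag]
    · by_cases hk : k = i
      · subst hk; simp [ofShift, ofDiag]
      · simp [ofShift, ofDiag, hk, sub_eq_zero]
    · simp [ofShift, ofDiag]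
  intro g hg
  obtain ⟨hsum, hs⟩ := mem_ker_sumShift.1 hg
  have hd : g.diag ∈ diagExponents M := by
    have heq : g.diag = ∑ i, (Pi.single i (g.diag i) - Pi.single 0 (g.diag i)) := by
      rw [Finset.sum_sub_distrib, Finset.univ_sum_single]
      have : ∑ i, Pi.single (0 : ZMod p) (g.diag i) =
          (Pi.single 0 (∑ i, g.diag i) : ZMod p → ZMod p) :=
        (map_sum (AddMonoidHom.single (fun _ : ZMod p => ZMod p) 0) g.diag Finset.univ).symm
      rw [this, hsum, Pi.single_zero, sub_zero]
    rw [heq]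
    exact sum_mem fun i _ => hdiff _ _
  rw [← ofTrans_trans_mul_ofDiag_diag_mul_ofShift g, hs]
  exact M.mul_mem (M.mul_mem (hVM (ofTrans_mem_translations _)) hd) M.one_mem

/-- A subgroup mapping onto the elementary abelian quotient supplements the translations. -/
theorem sup_translations_eq_top {K : Subgroup (AffineWreath χ)}
    (hK : K.map (sumShift (χ := χ)) = ⊤) : K ⊔ translations χ = ⊤ := by
  by_contra hne
  obtain ⟨M, hM, hle⟩ := (eq_top_or_exists_le_coatom (K ⊔ translations χ)).resolve_left hne
  have hker := ker_sumShift_le_of_isCoatom hM (le_sup_right.trans hle)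
  refine hM.1 (top_le_iff.1 fun g _ => ?_)
  obtain ⟨k, hk, hkg⟩ := (hK ▸ Subgroup.mem_top (sumShift g) : sumShift g ∈ K.map sumShift)
  have : k⁻¹ * g ∈ M := hker (by rw [MonoidHom.mem_ker, map_mul, map_inv, hkg, inv_mul_cancel])
  simpa using M.mul_mem (hle (Subgroup.mem_sup_left hk)) this

theorem surjective_sumShift : Function.Surjective (sumShift (χ := χ)) := by
  intro x
  refine ⟨⟨0, Pi.single 0 x.toAdd.1, x.toAdd.2⟩, ?_⟩
  simp [sumShift]

omit [Fact r.Prime] in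
theorem cardFactors_card_quotient :
    ArithmeticFunction.cardFactors (Nat.card (Multiplicative (ZMod p × ZMod p))) = 2 := by
  have hp : p.Prime := Fact.out
  rw [Nat.card_congr Multiplicative.toAdd, Nat.card_prod, Nat.card_zmod, ← pow_two,
    ArithmeticFunction.cardFactors_apply_prime_pow hp]

/-- An irredundant generating sequence has at most three members. -/
theorem le_three_of_irredundant (hχ : ∀ a, χ a = 1 → a = 0) {n : ℕ} {g : Fin n → AffineWreath χ}
    (hg : Irredundant g) (htop : Subgroup.closure (Set.range g) = ⊤) : n ≤ 3 := by
  obtain ⟨t, -, ht, hcard⟩ := exists_finset_closure_image_eq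
    (fun i => sumShift (g i)) Finset.univ
  rw [cardFactors_card_quotient] at hcard
  by_contra! hn
  have hK : (Subgroup.closure (g '' t)).map (sumShift (χ := χ)) = ⊤ := by
    rw [MonoidHom.map_closure, Set.image_image, ht, Finset.coe_univ, Set.image_univ,
      ← Function.comp_def, Set.range_comp, ← MonoidHom.map_closure, htop,
      Subgroup.map_top_of_surjective _ surjective_sumShift]
  have hsup := sup_translations_eq_top hK
  obtain ⟨i, hi, j, hj, hij⟩ : ∃ i, i ∉ t ∧ ∃ j, j ∉ t ∧ i ≠ j := by
    have : 1 < tᶜ.card := by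
      rw [Finset.card_compl, Fintype.card_fin]
      omega
    obtain ⟨i, hi, j, hj, hij⟩ := Finset.one_lt_card.1 this
    exact ⟨i, Finset.mem_compl.1 hi, j, Finset.mem_compl.1 hj, hij⟩
  have hti : Subgroup.closure (g '' t) ≤ Subgroup.closure (g '' {k | k ≠ i}) :=
    Subgroup.closure_mono (Set.image_mono fun k hk => fun e => hi (e ▸ hk))
  have htj : Subgroup.closure (g '' t) ≤ Subgroup.closure (g '' {k | k ≠ j}) :=
    Subgroup.closure_mono (Set.image_mono fun k hk => fun e => hj (e ▸ hk))
  have hco := isCoatom_of_sup_translations_eq_top hχ hsup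
    fun e => hg.notMem i (hti (e ▸ Subgroup.mem_top _))
  have hlt : Subgroup.closure (g '' t) < Subgroup.closure (g '' {k | k ≠ i}) := by
    refine lt_of_le_of_ne hti fun e => hg.notMem j (htj ?_)
    rw [e]
    exact Subgroup.subset_closure ⟨j, hij.symm, rfl⟩
  exact hg.notMem i (hco.2 _ hlt ▸ Subgroup.mem_top _)

theorem exists_irredundant_three (hχ : ∀ a, χ a = 1 → a = 0) :
    ∃ g : Fin 3 → AffineWreath χ, Irredundant g ∧ Subgroup.closure (Set.range g) = ⊤ := by
  set g : Fin 3 → AffineWreath χ :=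
    ![ofDiag χ (Pi.single 0 1), ofShift χ 1, ofTrans χ (Pi.single 0 1)] with hg
  have hmem : ∀ i, g i ∈ Subgroup.closure (Set.range g) := fun i => Subgroup.subset_closure ⟨i, rfl⟩
  refine ⟨g, irredundant_of_separating fun i => ?_, ?_⟩
  · fin_cases i
    · refine ⟨((AddMonoidHom.fst (ZMod p) (ZMod p)).toMultiplicative.comp sumShift).ker, ?_, ?_⟩
      · intro j hj
        fin_cases j <;> simp [hg, sumShift, ofDiag, ofShift, ofTrans] at hj ⊢
      · simp [hg, sumShift, ofDiag]
    · refine ⟨((AddMonoidHom.snd (ZMod p) (ZMod p)).toMultiplicative.comp sumShift).ker, ?_, ?_⟩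
      · intro j hj
        fin_cases j <;> simp [hg, sumShift, ofDiag, ofShift, ofTrans] at hj ⊢
      · simp [hg, sumShift, ofShift]
    · refine ⟨MulAction.stabilizer _ (0 : ZMod p → ZMod r), ?_, ?_⟩
      · intro j hj
        rw [MulAction.mem_stabilizer_iff]
        funext k
        fin_cases j <;> simp [hg, smul_apply, ofDiag, ofShift, ofTrans] at hj ⊢
      · intro h
        have := congrFun (MulAction.mem_stabilizer_iff.1 h) 0
        simp [hg, smul_apply, ofTrans] at this
  · refine eq_top_of_inf_translations_ne_bot hχ (sup_translations_eq_top ?_) fun hbot => ?_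
    · refine top_le_iff.1 fun x _ => ?_
      have hx : x = sumShift (g 0 ^ x.toAdd.1.val * g 1 ^ x.toAdd.2.val) := by
        rw [map_mul, map_pow, map_pow]
        refine Multiplicative.toAdd.injective (Prod.ext ?_ ?_) <;>
          simp [hg, sumShift, ofDiag, ofShift]
      rw [hx]
      exact Subgroup.mem_map_of_mem _
        (mul_mem (pow_mem (hmem 0) _) (pow_mem (hmem 1) _))
    · have h2 : g 2 ∈ Subgroup.closure (Set.range g) ⊓ translations χ :=
        ⟨hmem 2, ofTrans_mem_translations _⟩
      rw [hbot, Subgroup.mem_bot] at h2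
      have := congrFun (congrArg AffineWreath.trans h2) 0
      simp [hg, ofTrans] at this

theorem mInv_eq (hχ : ∀ a, χ a = 1 → a = 0) : mInv (AffineWreath χ) = 3 :=
  IsGreatest.csSup_eq ⟨exists_irredundant_three hχ, fun _ ⟨_, hg, htop⟩ =>
    le_three_of_irredundant hχ hg htop⟩

omit [Fact r.Prime] in
theorem exists_irredundant_two_mul [Nontrivial (ZMod r)] :
    ∃ g : Fin (2 * p) → AffineWreath χ, Irredundant g := by
  have hcard : Fintype.card (ZMod p ⊕ ZMod p) = 2 * p := by
    rw [Fintype.card_sum, ZMod.card, two_mul]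
  let e := (Fintype.equivFinOfCardEq hcard).symm
  let f : ZMod p ⊕ ZMod p → AffineWreath χ :=
    Sum.elim (fun i => ofTrans χ (Pi.single i 1)) fun i => ofDiag χ (Pi.single i 1)
  suffices h : ∀ a, ∃ L : Subgroup (AffineWreath χ), (∀ b, b ≠ a → f b ∈ L) ∧ f a ∉ L from
    ⟨f ∘ e, irredundant_of_separating fun i => (h (e i)).imp fun L hL =>
      ⟨fun j hj => hL.1 _ (e.injective.ne hj), hL.2⟩⟩
  rintro (i | i)
  · let L : Subgroup (AffineWreath χ) :=
      { carrier := {g | g.trans i = 0 ∧ g.shift = 0}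
        one_mem' := ⟨rfl, rfl⟩
        mul_mem' := fun {a b} ha hb => ⟨by simp [ha.1, ha.2, hb.1], by simp [ha.2, hb.2]⟩
        inv_mem' := fun {a} ha => ⟨by simp [ha.1, ha.2], by simp [ha.2]⟩ }
    refine ⟨L, ?_, fun h => by simpa [f, ofTrans] using h.1⟩
    rintro (j | j) hj
    · exact ⟨Pi.single_eq_of_ne (fun e => hj (by rw [e])) _, rfl⟩
    · exact ⟨rfl, rfl⟩
  · let L : Subgroup (AffineWreath χ) :=
      { carrier := {g | g.diag i = 0 ∧ g.shift = 0}
        one_mem' := ⟨rfl, rfl⟩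
        mul_mem' := fun {a b} ha hb => ⟨by simp [ha.1, ha.2, hb.1], by simp [ha.2, hb.2]⟩
        inv_mem' := fun {a} ha => ⟨by simp [ha.1, ha.2], by simp [ha.2]⟩ }
    refine ⟨L, ?_, fun h => by simpa [f, ofDiag] using h.1⟩
    rintro (j | j) hj
    · exact ⟨rfl, rfl⟩
    · exact ⟨Pi.single_eq_of_ne (fun e => hj (by rw [e])) _, rfl⟩

theorem iInv_eq (hχ : ∀ a, χ a = 1 → a = 0) : iInv (AffineWreath χ) = 2 * p := by
  refine IsGreatest.csSup_eq ⟨exists_irredundant_two_mul, fun n ⟨g, hg⟩ => ?_⟩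
  have hp : 2 ≤ p := (Fact.out : p.Prime).two_le
  rcases eq_or_lt_of_le (le_top : Subgroup.closure (Set.range g) ≤ ⊤) with htop | hlt
  · have := le_three_of_irredundant hχ hg htop
    omega
  · have h1 := cardFactors_card_lt_of_lt hlt
    have h2 := hg.le_cardFactors
    rw [Subgroup.card_top, cardFactors_card] at h1
    omega

theorem isCoatom_stabilizer (hχ : ∀ a, χ a = 1 → a = 0) (x : ZMod p → ZMod r) :
    IsCoatom (MulAction.stabilizer (AffineWreath χ) x) := by
  refine isCoatom_of_sup_translations_eq_top hχ (stabilizer_sup_translations x) fun h => ?_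
  have := (h ▸ Subgroup.mem_top _ : ofTrans χ 1 ∈ MulAction.stabilizer (AffineWreath χ) x)
  rw [MulAction.mem_stabilizer_iff, ofTrans_smul, add_eq_right] at this
  exact one_ne_zero this

/-- A maximal subgroup not containing the translations is a point stabilizer. -/
theorem exists_eq_stabilizer_of_isCoatom (hχ : ∀ a, χ a = 1 → a = 0) (hpr : p ≠ r)
    {M : Subgroup (AffineWreath χ)} (hM : IsCoatom M) (hV : ¬ translations χ ≤ M) :
    ∃ x : ZMod p → ZMod r, M = MulAction.stabilizer (AffineWreath χ) x := by
  have hsup : M ⊔ translations χ = ⊤ :=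
    hM.2 _ (lt_of_le_of_ne le_sup_left fun h => hV (h ▸ le_sup_right))
  have hbot : M ⊓ translations χ = ⊥ := by
    by_contra h
    exact hM.1 (eq_top_of_inf_translations_ne_bot hχ hsup h)
  have hP : IsPGroup p M := fun m => ⟨2, Subtype.ext <| by
    have : (m : AffineWreath χ) ^ p ^ 2 ∈ M ⊓ translations χ :=
      ⟨pow_mem m.2 _, pow_mem_translations _⟩
    rw [hbot] at this
    exact this⟩
  have hdvd : ¬ p ∣ Nat.card (ZMod p → ZMod r) := by
    rw [Nat.card_fun, Nat.card_zmod, Nat.card_zmod]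
    exact fun h => hpr ((Nat.prime_dvd_prime_iff_eq Fact.out Fact.out).1
      ((Fact.out : p.Prime).dvd_of_dvd_pow h))
  obtain ⟨x, hx⟩ := hP.nonempty_fixed_point_of_prime_not_dvd_card _ hdvd
  refine ⟨x, ?_⟩
  have hle : M ≤ MulAction.stabilizer (AffineWreath χ) x := fun m hm => hx ⟨m, hm⟩
  by_contra hne
  exact (isCoatom_stabilizer hχ x).1 (hM.2 _ (lt_of_le_of_ne hle hne))

theorem not_isNilpotent (hχ : ∀ a, χ a = 1 → a = 0) : ¬ Group.IsNilpotent (AffineWreath χ) := by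
  intro h
  have hn := Subgroup.NormalizerCondition.normal_of_coatom _
    (Group.normalizerCondition_of_isNilpotent (G := AffineWreath χ)) (isCoatom_stabilizer hχ 0)
  have hmem : ofDiag χ 1 ∈ MulAction.stabilizer (AffineWreath χ) (0 : ZMod p → ZMod r) := by
    rw [MulAction.mem_stabilizer_iff]
    funext i
    simp [smul_apply, ofDiag]
  have h0 := congrFun (MulAction.mem_stabilizer_iff.1 (hn.conj_mem _ hmem (ofTrans χ 1))) 0
  simp only [ofTrans, ofDiag, smul_apply, trans_mul, diag_mul, shift_mul, trans_inv] at h0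
  simp only [Pi.zero_apply, Pi.one_apply, AddChar.map_zero_eq_one, neg_zero, add_zero, zero_add,
    mul_zero, mul_one] at h0
  exact one_ne_zero (hχ 1 (by linear_combination -h0))

theorem exists_generalPosition (hχ : ∀ a, χ a = 1 → a = 0) :
    ∃ M : Fin p → Subgroup (AffineWreath χ), (∀ i, IsCoatom (M i)) ∧ GeneralPosition M := by
  let e := (Fintype.equivFinOfCardEq (ZMod.card p)).symm
  refine ⟨fun i => MulAction.stabilizer _ (Pi.single (e i) 1), fun i => isCoatom_stabilizer hχ _,
    generalPosition_iff.2 fun i => ⟨ofDiag χ (Pi.single (e i) 1), fun j hj => ?_, fun h => ?_⟩⟩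
  · rw [MulAction.mem_stabilizer_iff]
    funext k
    by_cases hk : k = e i
    · subst hk
      simp [smul_apply, ofDiag, hj.symm]
    · simp [smul_apply, ofDiag, hk]
  · have := congrFun (MulAction.mem_stabilizer_iff.1 h) (e i)
    simp only [smul_apply, ofDiag, Pi.single_eq_same, Pi.zero_apply, sub_zero, zero_add,
      mul_one] at this
    exact one_ne_zero (hχ 1 this)

/-- If some element fixing two given points has nonzero shift, only the identity fixes both points
and has zero shift. -/
theorem eq_one_of_shift_eq_zero (hχ : ∀ a, χ a = 1 → a = 0) {u w : ZMod p → ZMod r} (huw : u ≠ w)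
    {g k : AffineWreath χ} (hgu : g • u = u) (hgw : g • w = w) (hg : g.shift ≠ 0)
    (hku : k • u = u) (hkw : k • w = w) (hk : k.shift = 0) : k = 1 := by
  have hstep : ∀ i, u i ≠ w i → u (i - g.shift) ≠ w (i - g.shift) := by
    intro i hi h
    refine hi ?_
    rw [← congrFun hgu i, ← congrFun hgw i, smul_apply, smul_apply, h]
  obtain ⟨i₀, hi₀⟩ := Function.ne_iff.1 huw
  have hall : ∀ i, u i ≠ w i := by
    intro i
    have hn : ∀ n : ℕ, u (i₀ - n * g.shift) ≠ w (i₀ - n * g.shift) := by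
      intro n
      induction n with
      | zero => simpa using hi₀
      | succ n ih =>
        convert hstep _ ih using 2 <;> · push_cast; ring
    have := hn ((i₀ - i) / g.shift).val
    rwa [ZMod.natCast_zmod_val, div_mul_cancel₀ _ hg, sub_sub_cancel] at this
  have hd : ∀ i, k.diag i = 0 := by
    intro i
    have h1 := congrFun hku i
    have h2 := congrFun hkw i
    rw [smul_apply, hk, sub_zero] at h1 h2
    refine hχ _ (mul_right_cancel₀ (sub_ne_zero.2 (hall i)) ?_)
    linear_combination h1 - h2
  ext i
  · have h1 := congrFun hku i
    rw [smul_apply, hk, sub_zero, hd] at h1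
    simpa using h1
  · simp [hd]
  · simp [hk]

theorem le_of_generalPosition (hχ : ∀ a, χ a = 1 → a = 0) (hpr : p ≠ r) (hp : 3 ≤ p) {n : ℕ}
    {M : Fin n → Subgroup (AffineWreath χ)} (hM : ∀ i, IsCoatom (M i))
    (hgp : GeneralPosition M) : n ≤ p := by
  classical
  by_contra! hpn
  choose x hx hxi using generalPosition_iff.1 hgp
  set J : Finset (Fin n) := Finset.univ.filter fun i => translations χ ≤ M i with hJ
  have hker : ∀ j ∈ J, (sumShift (χ := χ)).ker ≤ M j := fun j hj =>
    ker_sumShift_le_of_isCoatom (hM j) (Finset.mem_filter.1 hj).2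
  have hpoint : ∀ i, ∃ v : ZMod p → ZMod r, i ∉ J → M i = MulAction.stabilizer _ v := by
    intro i
    by_cases hi : i ∈ J
    · exact ⟨0, fun h => absurd hi h⟩
    · obtain ⟨v, hv⟩ := exists_eq_stabilizer_of_isCoatom hχ hpr (hM i) (by simpa [hJ] using hi)
      exact ⟨v, fun _ => hv⟩
  choose v hv using hpoint
  have hfix : ∀ {i}, i ∉ J → ∀ {g}, g ∈ M i ↔ g • v i = v i := by
    intro i hi g
    rw [hv i hi, MulAction.mem_stabilizer_iff]
  have hJ2 : J.card ≤ 2 := by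
    rw [← cardFactors_card_quotient (p := p)]
    refine card_le_cardFactors_card J (fun i => sumShift (x i)) fun i hi hmem => hxi i ?_
    have hle : Subgroup.closure ((fun i => sumShift (x i)) '' {j | j ∈ J ∧ j ≠ i}) ≤
        (M i).map sumShift := by
      rw [Subgroup.closure_le]
      rintro _ ⟨j, hj, rfl⟩
      exact Subgroup.mem_map_of_mem _ (hx j i hj.2.symm)
    obtain ⟨m, hm, hmx⟩ := hle hmem
    have : m⁻¹ * x i ∈ M i :=
      hker i hi (by rw [MonoidHom.mem_ker, map_mul, map_inv, hmx, inv_mul_cancel])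
    simpa using (M i).mul_mem hm this
  have havoid : ∀ s : Finset (Fin n), s.card + J.card < n → ∃ i, i ∉ J ∧ i ∉ s := by
    intro s hs
    have hlt : (s ∪ J).card < (Finset.univ : Finset (Fin n)).card := by
      rw [Finset.card_univ, Fintype.card_fin]
      exact (Finset.card_union_le _ _).trans_lt hs
    obtain ⟨i, -, hi⟩ := Finset.exists_mem_notMem_of_card_lt_card hlt
    rw [Finset.mem_union, not_or] at hi
    exact ⟨i, hi.2, hi.1⟩
  have hne : ∀ {a b}, a ∉ J → b ∉ J → a ≠ b → v a ≠ v b := by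
    intro a b ha hb hab h
    exact hxi a ((hfix ha).2 (h ▸ (hfix hb).1 (hx a b hab.symm)))
  have hshift : ∀ {a b}, a ∉ J → b ∉ J → a ≠ b → ∀ g ∈ M a, g ∈ M b → g.shift = 0 := by
    intro a b ha hb hab g hga hgb
    by_contra hg
    have hone : ∀ k ∈ M a, k ∈ M b → k.shift = 0 → k = 1 := fun k hka hkb hk =>
      eq_one_of_shift_eq_zero hχ (hne ha hb hab) ((hfix ha).1 hga) ((hfix hb).1 hgb) hg
        ((hfix ha).1 hka) ((hfix hb).1 hkb) hk
    obtain ⟨c, hc, d, hd, hcd⟩ : ∃ c ∈ ({a, b}ᶜ : Finset (Fin n)),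
        ∃ d ∈ ({a, b}ᶜ : Finset (Fin n)), c ≠ d := by
      refine Finset.one_lt_card.1 ?_
      rw [Finset.card_compl, Fintype.card_fin, Finset.card_pair hab]
      omega
    simp only [Finset.mem_compl, Finset.mem_insert, Finset.mem_singleton, not_or] at hc hd
    have hca := hx c a (Ne.symm hc.1)
    have hcb := hx c b (Ne.symm hc.2)
    have hsc : (x c).shift ≠ 0 := fun h => hxi c (hone _ hca hcb h ▸ (M c).one_mem)
    set m := ((x d).shift / (x c).shift).val with hm
    have h1 : x d * (x c ^ m)⁻¹ = 1 := by
      refine hone _ ((M a).mul_mem (hx d a (Ne.symm hd.1)) (inv_mem (pow_mem hca _)))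
        ((M b).mul_mem (hx d b (Ne.symm hd.2)) (inv_mem (pow_mem hcb _))) ?_
      rw [shift_mul, shift_inv, shift_pow, hm, ZMod.natCast_zmod_val, div_mul_cancel₀ _ hsc,
        add_neg_cancel]
    rw [mul_inv_eq_one] at h1
    exact hxi d (h1 ▸ pow_mem (hx c d hcd.symm) m)
  have hJ1 : J.card ≤ 1 := by
    refine Finset.card_le_one.2 fun j hj j' hj' => ?_
    by_contra hjj
    obtain ⟨a, ha, -⟩ := havoid ∅ (by rw [Finset.card_empty]; omega)
    obtain ⟨b, hb, hba⟩ := havoid {a} (by rw [Finset.card_singleton]; omega)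
    have hab : a ≠ b := fun h => hba (by simp [h])
    have hs : ∀ i ∈ J, (x i).shift = 0 := fun i hi =>
      hshift ha hb hab _ (hx i a fun e => ha (e ▸ hi)) (hx i b fun e => hb (e ▸ hi))
    have hsum : ∑ i, (x j).diag i ≠ 0 := fun h =>
      hxi j (hker j hj (mem_ker_sumShift.2 ⟨h, hs j hj⟩))
    set m := ((∑ i, (x j').diag i) / ∑ i, (x j).diag i).val with hm
    have hk : x j' * (x j ^ m)⁻¹ ∈ (sumShift (χ := χ)).ker := by
      rw [mem_ker_sumShift]
      refine ⟨?_, by simp [shift_pow, hs j hj, hs j' hj']⟩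
      simp only [diag_mul, hs j' hj', sub_zero, diag_inv, shift_pow, hs j hj, mul_zero, add_zero,
        diag_pow_of_shift_eq_zero (hs j hj), Finset.sum_add_distrib, Finset.sum_neg_distrib]
      rw [← Finset.mul_sum, hm, ZMod.natCast_zmod_val, div_mul_cancel₀ _ hsum, add_neg_cancel]
    refine hxi j' ?_
    simpa using (M j').mul_mem (hker j' hj' hk) (pow_mem (hx j j' (Ne.symm hjj)) m)
  have hs : ∀ i, (x i).shift = 0 := by
    intro i
    obtain ⟨a, ha, hai⟩ := havoid {i} (by rw [Finset.card_singleton]; omega)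
    obtain ⟨b, hb, hbi⟩ := havoid {i, a}
      (by have := Finset.card_le_two (a := i) (b := a); omega)
    simp only [Finset.mem_insert, Finset.mem_singleton, not_or] at hai hbi
    exact hshift ha hb (Ne.symm hbi.2) _ (hx i a hai) (hx i b hbi.1)
  have hfix_apply : ∀ {i j}, j ∉ J → j ≠ i → ∀ c,
      (x i).trans c + χ ((x i).diag c) * v j c = v j c := by
    intro i j hj hji c
    have := congrFun ((hfix hj).1 (hx i j hji)) c
    rwa [smul_apply, hs, sub_zero] at this
  have hcoord : ∀ i, ∃ c, ((x i).diag c = 0 → (x i).trans c ≠ 0) ∧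
      (i ∉ J → (x i).trans c + χ ((x i).diag c) * v i c ≠ v i c) := by
    intro i
    by_cases hi : i ∈ J
    · obtain ⟨c, -, hc⟩ := Finset.exists_ne_zero_of_sum_ne_zero fun h =>
        hxi i (hker i hi (mem_ker_sumShift.2 ⟨h, hs i⟩))
      exact ⟨c, fun h => absurd h hc, fun h => absurd hi h⟩
    · obtain ⟨c, hc⟩ := Function.ne_iff.1 fun h => hxi i ((hfix hi).2 h)
      rw [smul_apply, hs, sub_zero] at hc
      exact ⟨c, fun h h' => hc (by simp [h, h']), fun _ => hc⟩
  choose c hc hcv using hcoord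
  have hagree : ∀ {i j k}, j ∉ J → k ∉ J → j ≠ i → k ≠ i → v j (c i) = v k (c i) := by
    intro i j k hj hk hji hki
    have h1 := hfix_apply hj hji (c i)
    have h2 := hfix_apply hk hki (c i)
    by_contra hjk
    have hd : (x i).diag (c i) = 0 :=
      hχ _ (mul_right_cancel₀ (sub_ne_zero.2 hjk) (by linear_combination h1 - h2))
    refine hc i hd ?_
    rw [hd, AddChar.map_zero_eq_one] at h1
    linear_combination h1
  have hcoll : ∀ i j, j ∉ J → c i = c j → i = j := by
    intro i j hj hij
    by_contra hne'
    obtain ⟨k, hk, hkij⟩ := havoid {i, j} (by rw [Finset.card_pair hne']; omega)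
    simp only [Finset.mem_insert, Finset.mem_singleton, not_or] at hkij
    refine hcv j hj ?_
    rw [← hij, hagree hj hk (Ne.symm hne') hkij.1]
    exact hfix_apply hk hkij.2 (c i)
  have hinj : Function.Injective c := by
    intro i j hij
    by_cases hj : j ∈ J
    · by_cases hi : i ∈ J
      · exact Finset.card_le_one.1 hJ1 _ hi _ hj
      · exact (hcoll j i hi hij.symm).symm
    · exact hcoll i j hj hij
  have := Fintype.card_le_of_injective c hinj
  rw [Fintype.card_fin, ZMod.card] at this
  omega

theorem mdInv_eq (hχ : ∀ a, χ a = 1 → a = 0) (hpr : p ≠ r) (hp : 3 ≤ p) :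
    mdInv (AffineWreath χ) = p :=
  IsGreatest.csSup_eq ⟨exists_generalPosition hχ,
    fun _ ⟨_, hM, hgp⟩ => le_of_generalPosition hχ hpr hp hM hgp⟩

end Structure

end AffineWreath

theorem exists_prime_injective_addChar (p : ℕ) [Fact p.Prime] :
    ∃ r : ℕ, r.Prime ∧ p ≠ r ∧ ∃ χ : AddChar (ZMod p) (ZMod r), ∀ a, χ a = 1 → a = 0 := by
  have hp : p.Prime := Fact.out
  obtain ⟨r, hr, hpr, hmod⟩ := Nat.exists_prime_gt_modEq_one p hp.ne_zero
  have : Fact r.Prime := ⟨hr⟩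
  have hdvd : p ∣ Fintype.card (ZMod r)ˣ := by
    rw [ZMod.card_units]
    exact (Nat.modEq_iff_dvd' hr.one_lt.le).1 hmod.symm
  obtain ⟨u, hu⟩ := exists_prime_orderOf_dvd_card p hdvd
  have hprim : IsPrimitiveRoot (u : ZMod r) p := by
    rw [IsPrimitiveRoot.coe_units_iff, ← hu]
    exact IsPrimitiveRoot.orderOf u
  refine ⟨r, hr, hpr.ne, AddChar.zmodChar p hprim.pow_eq_one, fun a ha => ?_⟩
  rw [AddChar.zmodChar_apply] at ha
  rw [← ZMod.val_eq_zero]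
  exact Nat.eq_zero_of_dvd_of_lt (hprim.dvd_of_pow_eq_one _ ha) (ZMod.val_lt a)

/-- For any odd prime `p` there is a finite group of Fitting length 2 with
`m(G) = 3`, `md(G) = p` and `i(G) = 2p`. -/
theorem exists_fitting_length_two_m_three_md_p (p : ℕ) (hp : p.Prime) (hodd : Odd p) :
    ∃ (G : Type) (_ : Group G), Finite G ∧
      (∃ (N : Subgroup G) (_ : N.Normal), Group.IsNilpotent N ∧ Group.IsNilpotent (G ⧸ N)) ∧
      ¬ Group.IsNilpotent G ∧
      mInv G = 3 ∧ mdInv G = p ∧ iInv G = 2 * p := by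
  have : Fact p.Prime := ⟨hp⟩
  obtain ⟨r, hr, hpr, χ, hχ⟩ := exists_prime_injective_addChar p
  have : Fact r.Prime := ⟨hr⟩
  have hp3 : 3 ≤ p := by
    have := hp.two_le
    obtain ⟨k, hk⟩ := hodd
    omega
  exact ⟨AffineWreath χ, inferInstance, inferInstance,
    ⟨AffineWreath.translations χ, inferInstance, inferInstance, inferInstance⟩,
    AffineWreath.not_isNilpotent hχ, AffineWreath.mInv_eq hχ, AffineWreath.mdInv_eq hχ hpr hp3,
    AffineWreath.iInv_eq hχ⟩
end

section
/- Let p and q be primes with p dividing q − 1, and let G_{q,p} = V ⋊ H be the semidirect product of V = F_q^p with the wreath product H = C ≀ ⟨σ⟩, where C is the subgroup of order p of F_q^* and σ = (1,2,…,p) ∈ Sym(p), acting on V by (f_1,…,f_p)^{(c_1,…,c_p)σ} = (f_{1σ^{-1}} c_{1σ^{-1}}, …, f_{pσ^{-1}} c_{pσ^{-1}}). Then m(G_{q,p}) = 3. -/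
/-- `V = F_q^p`, the `p`-dimensional vector space over the field with `q` elements. -/
abbrev Vqp (q p : ℕ) : Type := Fin p → ZMod q

/-- The permutation of `V = F_q^p` multiplying the `i`-th coordinate by the unit `c`. -/
def scalePerm (q p : ℕ) [Fact q.Prime] (c : (ZMod q)ˣ) (i : Fin p) : Equiv.Perm (Vqp q p) :=
  Equiv.piCongrRight fun j =>
    if j = i then Equiv.mulLeft₀ (c : ZMod q) c.ne_zero else Equiv.refl _

/-- The permutation of `V = F_q^p` induced by a permutation `e` of the coordinates:
`(f_1, …, f_p) ↦ (f_{1 e⁻¹}, …, f_{p e⁻¹})`. -/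
def coordPerm (q p : ℕ) (e : Equiv.Perm (Fin p)) : Equiv.Perm (Vqp q p) :=
  Equiv.arrowCongr e (Equiv.refl (ZMod q))

/-- The wreath product `H = C ≀ ⟨σ⟩` realized inside `Perm V`: the subgroup generated by the
scalings by `c` at each coordinate (which generate the base group `C^p`) together with the
cyclic coordinate permutation `σ = (1 2 … p)`.  Here `C = ⟨c⟩` is the subgroup of order `p`
of `F_q^*`. -/
def Hqp (q p : ℕ) [Fact q.Prime] (c : (ZMod q)ˣ) : Subgroup (Equiv.Perm (Vqp q p)) :=
  Subgroup.closure (Set.range (scalePerm q p c) ∪ {coordPerm q p (finRotate p)})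

/-- The group of translations of `V`, realized inside `Perm V`. -/
def Vtrans (q p : ℕ) : Subgroup (Equiv.Perm (Vqp q p)) :=
  Subgroup.closure (Set.range fun v : Vqp q p => Equiv.addLeft v)

/-- `G_{q,p} = V ⋊ H`, realized as the group of permutations of `V` of the form
`x ↦ x^h + v` with `h ∈ H`, `v ∈ V` (the action of `V ⋊ H` on `V` is faithful). -/
def Gqp (q p : ℕ) [Fact q.Prime] (c : (ZMod q)ˣ) : Subgroup (Equiv.Perm (Vqp q p)) :=
  Vtrans q p ⊔ Hqp q p c

/-- A maximal subgroup of a finite `p`-group is the kernel of a homomorphism to `ZMod p`. -/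
theorem IsPGroup.exists_hom_zmod_of_isCoatom {Q : Type*} [Group Q] [Finite Q] {p : ℕ}
    [Fact p.Prime] (hQ : IsPGroup p Q) {M : Subgroup Q} (hM : IsCoatom M) :
    ∃ χ : Additive Q →+ ZMod p, ∀ x : Q, χ (Additive.ofMul x) = 0 ↔ x ∈ M := by
  have hnil : Group.IsNilpotent Q := hQ.isNilpotent
  have hn : M.Normal := Subgroup.NormalizerCondition.normal_of_coatom M
    (Group.normalizerCondition_of_isNilpotent (G := Q)) hM
  have hQM : IsPGroup p (Q ⧸ M) := hQ.to_quotient M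
  have hcard : Nat.card (Q ⧸ M) = p := by
    have hdvd : p ∣ Nat.card (Q ⧸ M) := by
      refine hQM.card_eq_or_dvd.resolve_left fun h => hM.1 ?_
      exact Subgroup.index_eq_one.mp h
    obtain ⟨x, hx⟩ := exists_prime_orderOf_dvd_card' p hdvd
    have hlt : M < (Subgroup.zpowers x).comap (QuotientGroup.mk' M) := by
      refine lt_of_le_of_ne ?_ fun h => ?_
      · conv_lhs => rw [← QuotientGroup.ker_mk' M]
        exact Subgroup.ker_le_comap _ _
      · obtain ⟨y, rfl⟩ := QuotientGroup.mk'_surjective M x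
        have hy : y ∈ M := by
          rw [h]
          exact Subgroup.mem_zpowers _
        rw [QuotientGroup.mk'_apply, (QuotientGroup.eq_one_iff y).mpr hy, orderOf_one] at hx
        exact (Fact.out : p.Prime).one_lt.ne hx
    have htop : Subgroup.zpowers x = ⊤ := by
      rw [← Subgroup.map_comap_eq_self_of_surjective (QuotientGroup.mk'_surjective M)
        (Subgroup.zpowers x), hM.2 _ hlt]
      exact Subgroup.map_top_of_surjective _ (QuotientGroup.mk'_surjective M)
    rw [← hx, ← Nat.card_zpowers, htop, Subgroup.card_top]
  have hcyc : IsCyclic (Q ⧸ M) := isCyclic_of_prime_card hcard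
  have e : Additive (Q ⧸ M) ≃+ ZMod p :=
    (MulEquiv.toAdditiveLeft (zmodCyclicMulEquiv hcyc).symm).trans
      (ZMod.ringEquivCongr hcard).toAddEquiv
  refine ⟨e.toAddMonoidHom.comp (MonoidHom.toAdditive (QuotientGroup.mk' M)), fun x => ?_⟩
  rw [← QuotientGroup.eq_one_iff x]
  simp [← ofMul_one]

/-- Every generating family of a `2`-generated finite `p`-group contains a generating subfamily
with at most two members. -/
theorem IsPGroup.exists_finset_card_le_two {Q : Type*} [Group Q] [Finite Q] {p : ℕ}
    [Fact p.Prime] (hQ : IsPGroup p Q) {a b : Q} (hab : Subgroup.closure {a, b} = ⊤)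
    {ι : Type*} [Finite ι] {g : ι → Q} (hg : Subgroup.closure (Set.range g) = ⊤) :
    ∃ T : Finset ι, T.card ≤ 2 ∧ Subgroup.closure (g '' T) = ⊤ := by
  classical
  cases nonempty_fintype ι
  obtain ⟨T, hT⟩ := Set.Finite.exists_minimal
    (Set.toFinite {T : Finset ι | Subgroup.closure (g '' (T : Set ι)) = ⊤})
    ⟨Finset.univ, by simpa using hg⟩
  refine ⟨T, ?_, hT.1⟩
  have hχ : ∀ i : T, ∃ χ : Additive Q →+ ZMod p, χ (Additive.ofMul (g i)) ≠ 0 ∧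
      ∀ j : T, j ≠ i → χ (Additive.ofMul (g j)) = 0 := by
    intro i
    have hne : Subgroup.closure (g '' (T.erase i : Finset ι)) ≠ ⊤ := fun h =>
      Finset.notMem_erase (i : ι) T (hT.2 h (Finset.erase_subset _ _) i.2)
    obtain ⟨M, hM, hle⟩ := (eq_top_or_exists_le_coatom _).resolve_left hne
    obtain ⟨χ, hχ⟩ := hQ.exists_hom_zmod_of_isCoatom hM
    have hother : ∀ j : T, j ≠ i → g j ∈ M := fun j hj =>
      hle (Subgroup.subset_closure ⟨j, by simp [Subtype.coe_injective.ne hj], rfl⟩)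
    refine ⟨χ, fun h => hM.1 ?_, fun j hj => (hχ _).mpr (hother j hj)⟩
    rw [eq_top_iff, ← hT.1, Subgroup.closure_le]
    rintro _ ⟨j, hj, rfl⟩
    by_cases hji : (⟨j, hj⟩ : T) = i
    · subst hji
      exact (hχ _).mp h
    · exact hother ⟨j, hj⟩ hji
  choose χ hχi hχj using hχ
  have hli : LinearIndependent (ZMod p)
      fun i : T => ![χ i (Additive.ofMul a), χ i (Additive.ofMul b)] := by
    rw [Fintype.linearIndependent_iff]
    intro t ht i
    have h0 := congrFun ht 0
    have h1 := congrFun ht 1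
    simp only [Finset.sum_apply, Pi.smul_apply, Matrix.cons_val_zero, Matrix.cons_val_one,
      smul_eq_mul, Pi.zero_apply] at h0 h1
    have hall : ∀ x : Q, ∑ k, t k * χ k (Additive.ofMul x) = 0 := by
      intro x
      have hx : x ∈ Subgroup.closure {a, b} := hab ▸ Subgroup.mem_top x
      induction hx using Subgroup.closure_induction with
      | mem x hx =>
        rcases hx with rfl | rfl
        · exact h0
        · exact h1
      | one => simp
      | mul x y _ _ hx hy =>
        simp only [ofMul_mul, map_add, mul_add, Finset.sum_add_distrib, hx, hy, add_zero]
      | inv x _ hx =>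
        simp only [ofMul_inv, map_neg, mul_neg, Finset.sum_neg_distrib, hx, neg_zero]
    have hi := hall (g i)
    rw [Finset.sum_eq_single i (fun k _ hk => by rw [hχj k i hk.symm, mul_zero]) (by simp)] at hi
    exact (mul_eq_zero.mp hi).resolve_right (hχi i)
  simpa using hli.fintype_card_le_finrank

/-- If `V` is an abelian minimal normal subgroup, then any subgroup `K` supplementing `V` either
is the whole group or complements `V`. -/
theorem Subgroup.eq_top_or_inf_eq_bot_of_sup_eq_top {G : Type*} [Group G] {V K : Subgroup G}
    [V.Normal] (hcomm : ∀ x ∈ V, ∀ y ∈ V, x * y = y * x)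
    (hmin : ∀ N : Subgroup G, N.Normal → N ≤ V → N = ⊥ ∨ N = V) (hK : K ⊔ V = ⊤) :
    K = ⊤ ∨ K ⊓ V = ⊥ := by
  have hn : (K ⊓ V).Normal := by
    rw [← Subgroup.normalizer_eq_top_iff, eq_top_iff, ← hK, sup_le_iff]
    constructor
    · intro k hk
      rw [Subgroup.mem_normalizer_iff]
      intro x
      simp only [Subgroup.mem_inf]
      rw [Subgroup.mul_mem_cancel_right _ (K.inv_mem hk), Subgroup.mul_mem_cancel_left _ hk,
        ← Subgroup.Normal.mem_comm_iff ‹_›, inv_mul_cancel_left]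
    · intro v hv
      rw [Subgroup.mem_normalizer_iff]
      intro x
      by_cases hx : x ∈ V
      · rw [hcomm v hv x hx, mul_inv_cancel_right]
      · have : v * x * v⁻¹ ∉ V := by
          rwa [Subgroup.mul_mem_cancel_right _ (V.inv_mem hv), Subgroup.mul_mem_cancel_left _ hv]
        simp [hx, this]
  rcases hmin _ hn inf_le_right with h | h
  · exact Or.inr h
  · left
    rwa [sup_eq_left.mpr (inf_eq_right.mp h)] at hK

/-- If `V` is an abelian minimal normal subgroup of `G` with `G ⧸ V` a `2`-generated `p`-group,
then irredundant generating sequences of `G` have at most three members. -/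
theorem Irredundant.le_three {G : Type*} [Group G] [Finite G] {p : ℕ} [Fact p.Prime]
    {V : Subgroup G} [V.Normal] (hcomm : ∀ x ∈ V, ∀ y ∈ V, x * y = y * x)
    (hmin : ∀ N : Subgroup G, N.Normal → N ≤ V → N = ⊥ ∨ N = V)
    (hp : IsPGroup p (G ⧸ V)) {a b : G} (hab : Subgroup.closure {a, b} ⊔ V = ⊤)
    {n : ℕ} {g : Fin n → G} (hirr : Irredundant g) (hg : Subgroup.closure (Set.range g) = ⊤) :
    n ≤ 3 := by
  classical
  have hmap : ∀ s : Set G, Subgroup.closure (QuotientGroup.mk' V '' s) = ⊤ ↔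
      Subgroup.closure s ⊔ V = ⊤ := by
    intro s
    have h := Subgroup.comap_map_eq (QuotientGroup.mk' V) (Subgroup.closure s)
    rw [QuotientGroup.ker_mk'] at h
    rw [← MonoidHom.map_closure, ← h, ← Subgroup.comap_top (QuotientGroup.mk' V)]
    exact (Subgroup.comap_injective (QuotientGroup.mk'_surjective V)).eq_iff.symm
  have hfull : ∀ T : Finset (Fin n), Subgroup.closure (g '' T) = ⊤ → n ≤ T.card := by
    intro T hT
    have : T = Finset.univ := by
      refine Finset.eq_univ_of_forall fun i => ?_
      by_contra hi
      refine (hirr i).not_ge ?_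
      rw [hg, ← hT]
      exact Subgroup.closure_mono (Set.image_mono fun j hj h => hi (h ▸ hj))
    simp [this]
  have hab' : Subgroup.closure {QuotientGroup.mk' V a, QuotientGroup.mk' V b} = ⊤ := by
    rw [← Set.image_pair, hmap, hab]
  have hg' : Subgroup.closure (Set.range (QuotientGroup.mk' V ∘ g)) = ⊤ := by
    rw [Set.range_comp, hmap, hg, top_sup_eq]
  obtain ⟨T, hTcard, hT⟩ := hp.exists_finset_card_le_two hab' hg'
  rw [Set.image_comp, hmap] at hT
  rcases Subgroup.eq_top_or_inf_eq_bot_of_sup_eq_top hcomm hmin hT with h | h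
  · exact (hfull T h).trans (hTcard.trans (by norm_num))
  by_cases hall : ∀ i, g i ∈ Subgroup.closure (g '' T)
  · refine (hfull T ?_).trans (hTcard.trans (by norm_num))
    rw [eq_top_iff, ← hg, Subgroup.closure_le]
    rintro _ ⟨i, rfl⟩
    exact hall i
  push Not at hall
  obtain ⟨i, hi⟩ := hall
  have hle : Subgroup.closure (g '' T) ≤ Subgroup.closure (g '' (insert i T : Finset (Fin n))) :=
    Subgroup.closure_mono (Set.image_mono (by simp))
  have hsup : Subgroup.closure (g '' (insert i T : Finset (Fin n))) ⊔ V = ⊤ :=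
    top_le_iff.mp (hT ▸ sup_le_sup_right hle V)
  rcases Subgroup.eq_top_or_inf_eq_bot_of_sup_eq_top hcomm hmin hsup with h' | h'
  · have := hfull _ h'
    have := Finset.card_insert_le i T
    omega
  · have hmem : g i ∈ Subgroup.closure (g '' (insert i T : Finset (Fin n))) :=
      Subgroup.subset_closure ⟨i, by simp, rfl⟩
    refine absurd ?_ hi
    obtain ⟨k, hk, v, hv, hkv⟩ :=
      Subgroup.mem_sup_of_normal_right.mp (hT ▸ Subgroup.mem_top (g i))
    have hv1 : v ∈ Subgroup.closure (g '' (insert i T : Finset (Fin n))) ⊓ V := by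
      refine ⟨?_, hv⟩
      rw [← inv_mul_cancel_left k v, hkv]
      exact Subgroup.mul_mem _ (Subgroup.inv_mem _ (hle hk)) hmem
    rw [h', Subgroup.mem_bot] at hv1
    rwa [← hkv, hv1, mul_one]

theorem coordPerm_apply (q p : ℕ) (e : Equiv.Perm (Fin p)) (x : Vqp q p) (j : Fin p) :
    coordPerm q p e x j = x (e.symm j) := rfl

theorem coordPerm_pow (q p : ℕ) (e : Equiv.Perm (Fin p)) (k : ℕ) :
    coordPerm q p e ^ k = coordPerm q p (e ^ k) := by
  induction k with
  | zero => rfl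
  | succ k ih =>
    rw [pow_succ, ih, pow_succ]
    rfl

theorem coordPerm_single (q p : ℕ) (e : Equiv.Perm (Fin p)) (i : Fin p) (r : ZMod q) :
    coordPerm q p e (Pi.single i r) = Pi.single (e i) r := by
  ext j
  rw [coordPerm_apply, Pi.single_apply, Pi.single_apply]
  simp only [Equiv.symm_apply_eq]

theorem coordPerm_add (q p : ℕ) (e : Equiv.Perm (Fin p)) (x y : Vqp q p) :
    coordPerm q p e (x + y) = coordPerm q p e x + coordPerm q p e y := rfl

theorem scalePerm_apply (q p : ℕ) [Fact q.Prime] (c : (ZMod q)ˣ) (i : Fin p) (x : Vqp q p)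
    (j : Fin p) : scalePerm q p c i x j = if j = i then (c : ZMod q) * x j else x j := by
  simp only [scalePerm, Equiv.piCongrRight_apply, Pi.map_apply]
  split_ifs <;> rfl

theorem scalePerm_add (q p : ℕ) [Fact q.Prime] (c : (ZMod q)ˣ) (i : Fin p) (x y : Vqp q p) :
    scalePerm q p c i (x + y) = scalePerm q p c i x + scalePerm q p c i y := by
  ext j
  simp only [scalePerm_apply, Pi.add_apply]
  split_ifs <;> ring

theorem coordPerm_conj_scalePerm (q p : ℕ) [Fact q.Prime] (c : (ZMod q)ˣ)
    (e : Equiv.Perm (Fin p)) (i : Fin p) :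
    coordPerm q p e * scalePerm q p c i * (coordPerm q p e)⁻¹ = scalePerm q p c (e i) := by
  rw [mul_inv_eq_iff_eq_mul]
  ext x j
  simp only [Equiv.Perm.mul_apply, coordPerm_apply, scalePerm_apply, Equiv.symm_apply_eq]

theorem exists_finRotate_pow_apply_eq {p : ℕ} (hp : 2 ≤ p) (i j : Fin p) :
    ∃ k : ℕ, (finRotate p ^ k) i = j := by
  obtain ⟨n, rfl⟩ := Nat.exists_eq_add_of_le' hp
  have hmem : ∀ i : Fin (n + 2), finRotate (n + 2) i ≠ i := fun i =>
    Equiv.Perm.mem_support.mp (support_finRotate ▸ Finset.mem_univ i)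
  exact isCycle_finRotate.exists_pow_eq (hmem i) (hmem j)

theorem finRotate_pow_self {p : ℕ} (hp : 2 ≤ p) : finRotate p ^ p = 1 := by
  obtain ⟨n, rfl⟩ := Nat.exists_eq_add_of_le' hp
  have h := pow_orderOf_eq_one (finRotate (n + 2))
  rwa [isCycle_finRotate.orderOf, support_finRotate, Finset.card_univ, Fintype.card_fin] at h

/-- Only one coordinate scaling is needed to generate `H` together with the rotation. -/
theorem Hqp_eq_closure_pair (q p : ℕ) [Fact q.Prime] (hp : 2 ≤ p) (c : (ZMod q)ˣ) (i : Fin p) :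
    Hqp q p c = Subgroup.closure {scalePerm q p c i, coordPerm q p (finRotate p)} := by
  have hσ : coordPerm q p (finRotate p) ∈
      Subgroup.closure {scalePerm q p c i, coordPerm q p (finRotate p)} :=
    Subgroup.subset_closure (by simp)
  apply le_antisymm
  · rw [Hqp, Subgroup.closure_le]
    rintro _ (⟨j, rfl⟩ | rfl)
    · obtain ⟨k, rfl⟩ := exists_finRotate_pow_apply_eq hp i j
      rw [← coordPerm_conj_scalePerm, ← coordPerm_pow]
      have hk := Subgroup.pow_mem _ hσ k
      exact Subgroup.mul_mem _ (Subgroup.mul_mem _ hk (Subgroup.subset_closure (by simp)))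
        (Subgroup.inv_mem _ hk)
    · exact hσ
  · refine Subgroup.closure_mono ?_
    rintro _ (rfl | rfl)
    · exact Or.inl ⟨i, rfl⟩
    · exact Or.inr rfl

theorem isPGroup_Hqp (q p : ℕ) [Fact q.Prime] (hp : 2 ≤ p) (c : (ZMod q)ˣ) (hc : c ^ p = 1) :
    IsPGroup p (Hqp q p c) := by
  have : NeZero q := ⟨(Fact.out : q.Prime).ne_zero⟩
  let D : (Fin p → (ZMod q)ˣ) →* Equiv.Perm (Vqp q p) := MulAction.toPermHom _ _
  let B : Subgroup (Equiv.Perm (Vqp q p)) := (powMonoidHom p).ker.map D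
  let Z : Subgroup (Equiv.Perm (Vqp q p)) := Subgroup.zpowers (coordPerm q p (finRotate p))
  have hB : IsPGroup p B := by
    refine IsPGroup.map (fun d => ⟨1, ?_⟩) D
    rw [pow_one]
    exact Subtype.ext d.2
  have hZ : IsPGroup p Z := by
    refine IsPGroup.of_card_dvd_pow (n := 1) ?_
    rw [pow_one, Nat.card_zpowers, orderOf_dvd_iff_pow_eq_one, coordPerm_pow,
      finRotate_pow_self hp]
    rfl
  have hconj : ∀ d : Fin p → (ZMod q)ˣ, coordPerm q p (finRotate p) * D d *
      (coordPerm q p (finRotate p))⁻¹ = D fun j => d ((finRotate p).symm j) := by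
    intro d
    rw [mul_inv_eq_iff_eq_mul]
    ext x j
    rfl
  have hZB : Z ≤ Subgroup.normalizer (B : Set (Equiv.Perm (Vqp q p))) := by
    rw [Subgroup.zpowers_le]
    refine Subgroup.mem_normalizer_fintype ?_
    rintro _ ⟨d, hd, rfl⟩
    rw [hconj]
    refine ⟨_, ?_, rfl⟩
    have hd' : d ^ p = 1 := hd
    ext j
    simpa using congrArg Units.val (congrFun hd' ((finRotate p).symm j))
  refine (IsPGroup.to_sup_of_normal_right' hZ hB hZB).to_le ?_
  rw [Hqp, Subgroup.closure_le]
  rintro _ (⟨i, rfl⟩ | rfl)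
  · refine Subgroup.mem_sup_right ⟨Pi.mulSingle i c, ?_, ?_⟩
    · change (Pi.mulSingle i c : Fin p → (ZMod q)ˣ) ^ p = 1
      rw [← Pi.mulSingle_pow, hc, Pi.mulSingle_one]
    · ext x j
      rw [scalePerm_apply]
      change ((Pi.mulSingle i c : Fin p → (ZMod q)ˣ) j : ZMod q) * x j = _
      rw [Pi.mulSingle_apply]
      split_ifs <;> simp
  · exact Subgroup.mem_sup_left (Subgroup.mem_zpowers _)

theorem mem_Vtrans {q p : ℕ} {f : Equiv.Perm (Vqp q p)} :
    f ∈ Vtrans q p ↔ ∃ v, Equiv.addLeft v = f := by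
  refine ⟨fun h => ?_, fun h => Subgroup.subset_closure h⟩
  induction h using Subgroup.closure_induction with
  | mem f hf => exact hf
  | one => exact ⟨0, by ext; simp⟩
  | mul f g _ _ hf hg =>
    obtain ⟨v, rfl⟩ := hf
    obtain ⟨w, rfl⟩ := hg
    exact ⟨v + w, by ext; simp⟩
  | inv f _ hf =>
    obtain ⟨v, rfl⟩ := hf
    exact ⟨-v, by ext; simp⟩

theorem Vtrans_mul_comm {q p : ℕ} {f g : Equiv.Perm (Vqp q p)} (hf : f ∈ Vtrans q p)
    (hg : g ∈ Vtrans q p) : f * g = g * f := by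
  obtain ⟨v, rfl⟩ := mem_Vtrans.mp hf
  obtain ⟨w, rfl⟩ := mem_Vtrans.mp hg
  ext x : 1
  simp [add_left_comm]

theorem conj_addLeft {A : Type*} [AddGroup A] {f : Equiv.Perm A}
    (hf : ∀ x y, f (x + y) = f x + f y) (v : A) :
    f * Equiv.addLeft v * f⁻¹ = Equiv.addLeft (f v) := by
  rw [mul_inv_eq_iff_eq_mul]
  ext x
  simp [hf]

theorem Gqp_le_normalizer_Vtrans (q p : ℕ) [Fact q.Prime] (c : (ZMod q)ˣ) :
    Gqp q p c ≤ Subgroup.normalizer (Vtrans q p : Set (Equiv.Perm (Vqp q p))) := by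
  have : NeZero q := ⟨(Fact.out : q.Prime).ne_zero⟩
  have key : ∀ f : Equiv.Perm (Vqp q p), (∀ x y, f (x + y) = f x + f y) →
      f ∈ Subgroup.normalizer (Vtrans q p : Set (Equiv.Perm (Vqp q p))) := by
    intro f hf
    refine Subgroup.mem_normalizer_fintype fun g hg => ?_
    obtain ⟨v, rfl⟩ := mem_Vtrans.mp hg
    exact mem_Vtrans.mpr ⟨f v, (conj_addLeft hf v).symm⟩
  refine sup_le Subgroup.le_normalizer ?_
  rw [Hqp, Subgroup.closure_le]
  rintro _ (⟨i, rfl⟩ | rfl)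
  · exact key _ (scalePerm_add q p c i)
  · exact key _ (coordPerm_add q p _)

/-- `V` is an irreducible module for the group generated by scalings and the rotation. -/
theorem AddSubgroup.eq_top_of_scalePerm_of_coordPerm {q p : ℕ} [Fact q.Prime] (hp : 2 ≤ p)
    {c : (ZMod q)ˣ} (hc : c ≠ 1) {A : AddSubgroup (Vqp q p)} {v : Vqp q p} (hv : v ∈ A)
    (hv0 : v ≠ 0) (hs : ∀ i, ∀ x ∈ A, scalePerm q p c i x ∈ A)
    (hr : ∀ x ∈ A, coordPerm q p (finRotate p) x ∈ A) : A = ⊤ := by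
  obtain ⟨i, hi⟩ := Function.ne_iff.mp hv0
  have hc' : (c : ZMod q) - 1 ≠ 0 := fun h => hc (Units.ext (sub_eq_zero.mp h))
  have hsub : scalePerm q p c i v - v = Pi.single i (((c : ZMod q) - 1) * v i) := by
    ext j
    rw [Pi.sub_apply, scalePerm_apply, Pi.single_apply]
    split_ifs with h
    · subst h
      ring
    · ring
  have hsingle : ∀ r : ZMod q, Pi.single i r ∈ A := by
    intro r
    have h := ZMod.smul_mem (K := A) (hsub ▸ A.sub_mem (hs i v hv) hv)
      (r * (((c : ZMod q) - 1) * v i)⁻¹)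
    rwa [← Pi.single_smul, smul_eq_mul, inv_mul_cancel_right₀ (mul_ne_zero hc' hi)] at h
  have hpow : ∀ k : ℕ, ∀ x ∈ A, (coordPerm q p (finRotate p) ^ k) x ∈ A := by
    intro k
    induction k with
    | zero => exact fun x hx => hx
    | succ k ih =>
      intro x hx
      rw [pow_succ]
      exact ih _ (hr x hx)
  rw [eq_top_iff]
  intro w _
  rw [← Finset.univ_sum_single w]
  refine A.sum_mem fun j _ => ?_
  obtain ⟨k, rfl⟩ := exists_finRotate_pow_apply_eq hp i j
  rw [← coordPerm_single, ← coordPerm_pow]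
  exact hpow k _ (hsingle _)

/-- A subgroup of permutations of `V` which is normalized by `H` and contains a nontrivial
translation contains all translations. -/
theorem Vtrans_le_of_mem {q p : ℕ} [Fact q.Prime] (hp : 2 ≤ p) {c : (ZMod q)ˣ} (hc : c ≠ 1)
    {K : Subgroup (Equiv.Perm (Vqp q p))} {v : Vqp q p} (hv : Equiv.addLeft v ∈ K) (hv0 : v ≠ 0)
    (hK : ∀ h ∈ Hqp q p c, ∀ k ∈ K, h * k * h⁻¹ ∈ K) : Vtrans q p ≤ K := by
  let A : AddSubgroup (Vqp q p) :=
    { carrier := {w | Equiv.addLeft w ∈ K}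
      zero_mem' := by
        change Equiv.addLeft (0 : Vqp q p) ∈ K
        convert K.one_mem
        ext
        simp
      add_mem' := by
        intro x y hx hy
        change Equiv.addLeft (x + y) ∈ K
        convert K.mul_mem hx hy
        ext
        simp
      neg_mem' := by
        intro x hx
        change Equiv.addLeft (-x) ∈ K
        convert K.inv_mem hx
        ext
        simp }
  have hA : A = ⊤ := by
    refine AddSubgroup.eq_top_of_scalePerm_of_coordPerm hp hc (A := A) hv hv0 ?_ ?_
    · intro i x hx
      change Equiv.addLeft _ ∈ K
      rw [← conj_addLeft (scalePerm_add q p c i)]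
      exact hK _ (Subgroup.subset_closure (Or.inl ⟨i, rfl⟩)) _ hx
    · intro x hx
      change Equiv.addLeft _ ∈ K
      rw [← conj_addLeft (coordPerm_add q p _)]
      exact hK _ (Subgroup.subset_closure (Or.inr rfl)) _ hx
  rw [Vtrans, Subgroup.closure_le]
  rintro _ ⟨w, rfl⟩
  have hw : w ∈ A := hA ▸ AddSubgroup.mem_top w
  exact hw

theorem Subgroup.closure_perm_preserves {α : Type*} {S : Set (Equiv.Perm α)} {R : α → α → Prop}
    (hS : ∀ f ∈ S, ∀ x y, R (f x) (f y) ↔ R x y) {f : Equiv.Perm α}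
    (hf : f ∈ Subgroup.closure S) : ∀ x y, R (f x) (f y) ↔ R x y := by
  induction hf using Subgroup.closure_induction with
  | mem f hf => exact hS f hf
  | one => exact fun x y => Iff.rfl
  | mul f g _ _ hf hg => exact fun x y => (hf _ _).trans (hg _ _)
  | inv f _ hf =>
    intro x y
    rw [← hf, Equiv.Perm.coe_inv, f.apply_symm_apply, f.apply_symm_apply]

theorem Gqp_le_three {p q n : ℕ} [Fact p.Prime] [Fact q.Prime] {c : (ZMod q)ˣ}
    (hc : orderOf c = p) {g : Fin n → Gqp q p c} (hirr : Irredundant g)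
    (hg : Subgroup.closure (Set.range g) = ⊤) : n ≤ 3 := by
  have : NeZero q := ⟨(Fact.out : q.Prime).ne_zero⟩
  have hp : 2 ≤ p := (Fact.out : p.Prime).two_le
  have hc1 : c ≠ 1 := fun h => by
    rw [h, orderOf_one] at hc
    omega
  have hHG : Hqp q p c ≤ Gqp q p c := le_sup_right
  have hVG : Vtrans q p ≤ Gqp q p c := le_sup_left
  have hN : ((Vtrans q p).subgroupOf (Gqp q p c)).Normal :=
    (Subgroup.normal_subgroupOf_iff_le_normalizer hVG).mpr (Gqp_le_normalizer_Vtrans q p c)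
  have hsup : (Hqp q p c).subgroupOf (Gqp q p c) ⊔ (Vtrans q p).subgroupOf (Gqp q p c) = ⊤ := by
    rw [← Subgroup.subgroupOf_sup hHG hVG, sup_comm]
    exact Subgroup.subgroupOf_self (Gqp q p c)
  let i₀ : Fin p := ⟨0, by omega⟩
  have hs : scalePerm q p c i₀ ∈ Gqp q p c := hHG (Subgroup.subset_closure (Or.inl ⟨_, rfl⟩))
  have hr : coordPerm q p (finRotate p) ∈ Gqp q p c :=
    hHG (Subgroup.subset_closure (Or.inr rfl))
  have hpair : Subgroup.closure {(⟨_, hs⟩ : Gqp q p c), ⟨_, hr⟩} =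
      (Hqp q p c).subgroupOf (Gqp q p c) := by
    refine Subgroup.map_injective (Gqp q p c).subtype_injective ?_
    rw [MonoidHom.map_closure, Set.image_pair, Subgroup.map_subgroupOf_eq_of_le hHG,
      Hqp_eq_closure_pair q p hp c i₀]
    rfl
  refine hirr.le_three (p := p) (V := (Vtrans q p).subgroupOf (Gqp q p c))
    (fun x hx y hy => Subtype.ext (Vtrans_mul_comm hx hy)) (fun N hNn hNV => ?_) ?_
    (hpair ▸ hsup) hg
  · refine or_iff_not_imp_left.mpr fun hbot => le_antisymm hNV ?_
    obtain ⟨⟨x, hx⟩, hx1⟩ := Subgroup.ne_bot_iff_exists_ne_one.mp hbot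
    obtain ⟨v, hv⟩ := mem_Vtrans.mp (Subgroup.mem_subgroupOf.mp (hNV hx))
    have hv0 : v ≠ 0 := by
      rintro rfl
      refine hx1 (Subtype.ext (Subtype.ext ?_))
      change (x : Equiv.Perm (Vqp q p)) = 1
      rw [← hv]
      ext
      simp
    have hle : Vtrans q p ≤ N.map (Gqp q p c).subtype := by
      refine Vtrans_le_of_mem hp hc1 (v := v) ⟨x, hx, hv.symm⟩ hv0 ?_
      rintro h hh _ ⟨k, hk, rfl⟩
      exact ⟨⟨h, hHG hh⟩ * k * ⟨h, hHG hh⟩⁻¹, hNn.conj_mem k hk _, rfl⟩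
    intro y hy
    obtain ⟨z, hz, hzy⟩ := hle (Subgroup.mem_subgroupOf.mp hy)
    rwa [← Subtype.ext hzy]
  · have hH : IsPGroup p ((Hqp q p c).subgroupOf (Gqp q p c)) :=
      (isPGroup_Hqp q p hp c (hc ▸ pow_orderOf_eq_one c)).comap_subtype
    have hmap := hH.map (QuotientGroup.mk' ((Vtrans q p).subgroupOf (Gqp q p c)))
    have htop : ((Hqp q p c).subgroupOf (Gqp q p c)).map
        (QuotientGroup.mk' ((Vtrans q p).subgroupOf (Gqp q p c))) = ⊤ := by
      have h := congrArg (Subgroup.map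
        (QuotientGroup.mk' ((Vtrans q p).subgroupOf (Gqp q p c)))) hsup
      rwa [Subgroup.map_sup, QuotientGroup.map_mk'_self, sup_bot_eq,
        Subgroup.map_top_of_surjective _ (QuotientGroup.mk'_surjective _)] at h
    rw [htop] at hmap
    exact hmap.of_equiv Subgroup.topEquiv

theorem exists_irredundant_three {p q : ℕ} [Fact p.Prime] [Fact q.Prime] {c : (ZMod q)ˣ}
    (hc : orderOf c = p) :
    ∃ g : Fin 3 → Gqp q p c, Irredundant g ∧ Subgroup.closure (Set.range g) = ⊤ := by
  have hp : 2 ≤ p := (Fact.out : p.Prime).two_le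
  have hc1 : c ≠ 1 := fun h => by
    rw [h, orderOf_one] at hc
    omega
  have hcz : (c : ZMod q) ≠ 1 := fun h => hc1 (Units.ext h)
  let i₀ : Fin p := ⟨0, by omega⟩
  have hi₀ : finRotate p i₀ ≠ i₀ := by
    obtain ⟨n, rfl⟩ := Nat.exists_eq_add_of_le' hp
    exact Equiv.Perm.mem_support.mp (support_finRotate ▸ Finset.mem_univ i₀)
  let e : Vqp q p := Pi.single i₀ 1
  have he : e ≠ 0 := fun h => one_ne_zero (Pi.single_eq_zero_iff.mp h)
  have hmem : ∀ i, ![scalePerm q p c i₀, coordPerm q p (finRotate p), Equiv.addLeft e] i ∈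
      Gqp q p c := by
    have h0 : scalePerm q p c i₀ ∈ Gqp q p c :=
      Subgroup.mem_sup_right (Subgroup.subset_closure (Or.inl ⟨_, rfl⟩))
    have h1 : coordPerm q p (finRotate p) ∈ Gqp q p c :=
      Subgroup.mem_sup_right (Subgroup.subset_closure (Or.inr rfl))
    have h2 : Equiv.addLeft e ∈ Gqp q p c :=
      Subgroup.mem_sup_left (Subgroup.subset_closure ⟨_, rfl⟩)
    intro i
    fin_cases i
    exacts [h0, h1, h2]
  let f : Fin 3 → Equiv.Perm (Vqp q p) :=
    ![scalePerm q p c i₀, coordPerm q p (finRotate p), Equiv.addLeft e]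
  let g : Fin 3 → Gqp q p c := fun i => ⟨f i, hmem i⟩
  have hR : ∀ (i : Fin 3) (R : Vqp q p → Vqp q p → Prop),
      (∀ j ≠ i, ∀ x y, R (f j x) (f j y) ↔ R x y) →
      (∃ x y, ¬(R (f i x) (f i y) ↔ R x y)) →
      Subgroup.closure (g '' {j | j ≠ i}) < Subgroup.closure (Set.range g) := by
    rintro i R hj ⟨x, y, hxy⟩
    refine lt_of_le_not_ge (Subgroup.closure_mono (Set.image_subset_range _ _)) fun hle => hxy ?_
    have hi := Subgroup.mem_map_of_mem (Gqp q p c).subtype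
      (hle (Subgroup.subset_closure ⟨i, rfl⟩))
    rw [MonoidHom.map_closure, Set.image_image] at hi
    refine Subgroup.closure_perm_preserves (R := R) ?_ hi x y
    rintro _ ⟨j, hji, rfl⟩
    exact hj j hji
  have hsum : ∀ x : Vqp q p, ∑ j, coordPerm q p (finRotate p) x j = ∑ j, x j := fun x =>
    Equiv.sum_comp (finRotate p).symm x
  refine ⟨g, fun i => ?_, ?_⟩
  · fin_cases i
    · refine hR 0 (fun x y => ∑ j, x j = ∑ j, y j) ?_
        ⟨e, coordPerm q p (finRotate p) e, ?_⟩
      · intro j hj x y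
        fin_cases j
        · exact absurd rfl hj
        · simp [f, hsum]
        · simp [f, Finset.sum_add_distrib]
      · have h0 : scalePerm q p c i₀ e = Pi.single i₀ (c : ZMod q) := by
          ext j
          by_cases h : j = i₀ <;> simp [scalePerm_apply, e, h]
        have h1 : scalePerm q p c i₀ (coordPerm q p (finRotate p) e) =
            coordPerm q p (finRotate p) e := by
          ext j
          rw [scalePerm_apply, coordPerm_single]
          split_ifs with h
          · rw [h, Pi.single_eq_of_ne hi₀.symm, mul_zero]
          · rfl
        change ¬(∑ j, scalePerm q p c i₀ e j =
          ∑ j, scalePerm q p c i₀ (coordPerm q p (finRotate p) e) j ↔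
          ∑ j, e j = ∑ j, coordPerm q p (finRotate p) e j)
        rw [h0, h1, hsum, Finset.sum_pi_single', Finset.sum_pi_single']
        simpa using hcz
    · refine hR 1 (fun x y => x i₀ = y i₀) ?_ ⟨0, Pi.single i₀ 1, ?_⟩
      · intro j hj x y
        fin_cases j
        · simp [f, scalePerm_apply]
        · exact absurd rfl hj
        · simp [f]
      · change ¬((0 : ZMod q) = coordPerm q p (finRotate p) (Pi.single i₀ 1) i₀ ↔
          (0 : ZMod q) = Pi.single (M := fun _ => ZMod q) i₀ 1 i₀)
        rw [coordPerm_single, Pi.single_eq_of_ne hi₀.symm]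
        simp
    · have hscale0 : scalePerm q p c i₀ 0 = 0 := by
        ext
        simp [scalePerm_apply]
      have hcoord0 : coordPerm q p (finRotate p) 0 = 0 := rfl
      refine hR 2 (fun x _ => x = 0) ?_ ⟨0, 0, ?_⟩
      · intro j hj x y
        fin_cases j
        · exact ⟨fun h => (scalePerm q p c i₀).injective (h.trans hscale0.symm),
            fun h => h ▸ hscale0⟩
        · exact ⟨fun h => (coordPerm q p (finRotate p)).injective (h.trans hcoord0.symm),
            fun h => h ▸ hcoord0⟩
        · exact absurd rfl hj
      · simpa [f] using he
  · refine Subgroup.map_injective (Gqp q p c).subtype_injective ?_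
    rw [MonoidHom.map_closure, ← Set.range_comp, ← MonoidHom.range_eq_map, Subgroup.range_subtype]
    change Subgroup.closure (Set.range f) = _
    have hfK : ∀ i, f i ∈ Subgroup.closure (Set.range f) := fun i =>
      Subgroup.subset_closure ⟨i, rfl⟩
    refine le_antisymm ((Subgroup.closure_le _).mpr (Set.range_subset_iff.mpr hmem)) ?_
    have hH : Hqp q p c ≤ Subgroup.closure (Set.range f) := by
      rw [Hqp_eq_closure_pair q p hp c i₀, Subgroup.closure_le]
      rintro _ (rfl | rfl)
      exacts [hfK 0, hfK 1]
    refine sup_le (Vtrans_le_of_mem hp hc1 (v := e) (hfK 2) he fun h hh k hk => ?_) hH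
    exact Subgroup.mul_mem _ (Subgroup.mul_mem _ (hH hh) hk) (Subgroup.inv_mem _ (hH hh))

/-- Proposition 5: `m(G_{q,p}) = 3`. -/
theorem m_Gqp_eq_three (p q : ℕ) [Fact p.Prime] [Fact q.Prime] (hpq : p ∣ q - 1)
    (c : (ZMod q)ˣ) (hc : orderOf c = p) :
    mInv ↥(Gqp q p c) = 3 := by
  refine IsGreatest.csSup_eq ⟨exists_irredundant_three hc, ?_⟩
  rintro n ⟨g, hirr, hg⟩
  exact Gqp_le_three hc hirr hg
end

section
/- Let p and q be primes with p dividing q − 1 and let G_{q,p} = V ⋊ H be as defined. Let v_1 = (x_1,…,x_p) and v_2 = (y_1,…,y_p) be two distinct elements of V = F_q^p and let Δ(v_1,v_2) = {i ∈ {1,…,p} : x_i = y_i}. If |Δ(v_1,v_2)| = 0, then |H^{v_1} ∩ H^{v_2}| ≤ p; if |Δ(v_1,v_2)| = u ≠ 0, then |H^{v_1} ∩ H^{v_2}| = p^u. -/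
/-- The conjugate `H^v = v⁻¹ H v` of `H` by the translation by `v`, as a subgroup of
`Perm V`. -/
def HconjPerm (q p : ℕ) [Fact q.Prime] (c : (ZMod q)ˣ) (v : Vqp q p) :
    Subgroup (Equiv.Perm (Vqp q p)) :=
  (Hqp q p c).map (MulAut.conj (Equiv.addLeft v)⁻¹).toMonoidHom

/-- The subgroup of `Perm V` of monomial maps `x ↦ (a j * x (j + k))_j` whose coefficients `a j`
lie in the subgroup generated by `c`. -/
def cyclicMonomial (q p : ℕ) [NeZero p] (c : (ZMod q)ˣ) : Subgroup (Equiv.Perm (Vqp q p)) where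
  carrier := {h | ∃ (k : Fin p) (a : Fin p → (ZMod q)ˣ),
    (∀ i, a i ∈ Subgroup.zpowers c) ∧ ∀ x j, h x j = a j * x (j + k)}
  one_mem' := ⟨0, 1, fun _ => one_mem _, fun x j => by simp⟩
  mul_mem' := by
    rintro g h ⟨k, a, ha, hg⟩ ⟨l, b, hb, hh⟩
    refine ⟨k + l, fun j => a j * b (j + k), fun i => mul_mem (ha _) (hb _), fun x j => ?_⟩
    rw [Equiv.Perm.mul_apply, hg, hh, Units.val_mul, mul_assoc, add_assoc]
  inv_mem' := by
    rintro g ⟨k, a, ha, hg⟩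
    refine ⟨-k, fun j => (a (j + -k))⁻¹, fun i => inv_mem (ha _), fun x j => ?_⟩
    obtain ⟨y, rfl⟩ := g.surjective x
    rw [Equiv.Perm.coe_inv, Equiv.symm_apply_apply, hg, Units.inv_mul_cancel_left, neg_add_cancel_right]

theorem finRotate_symm_apply_add_one (p : ℕ) [NeZero p] (j : Fin p) :
    (finRotate p).symm j + 1 = j := by
  rw [← finRotate_apply, Equiv.apply_symm_apply]

theorem Hqp_le_cyclicMonomial (q p : ℕ) [NeZero p] [Fact q.Prime] (c : (ZMod q)ˣ) :
    Hqp q p c ≤ cyclicMonomial q p c := by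
  rw [Hqp, Subgroup.closure_le]
  rintro _ (⟨i, rfl⟩ | rfl)
  · refine ⟨0, fun j => if j = i then c else 1, fun j => ?_, fun x j => ?_⟩
    · dsimp only
      split_ifs
      · exact Subgroup.mem_zpowers c
      · exact one_mem _
    · by_cases hj : j = i <;> simp [scalePerm, hj]
  · refine ⟨-1, 1, fun _ => one_mem _, fun x j => ?_⟩
    have h : (finRotate p).symm j = j + -1 :=
      eq_add_neg_of_add_eq (finRotate_symm_apply_add_one p j)
    simp [coordPerm, Equiv.arrowCongr, h]

/-- The diagonal action of `(F_q^*)^p` on `V = F_q^p`. -/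
def diagPerm (q p : ℕ) : (Fin p → (ZMod q)ˣ) →* Equiv.Perm (Vqp q p) :=
  MulAction.toPermHom (Fin p → (ZMod q)ˣ) (Vqp q p)

theorem diagPerm_apply (q p : ℕ) (a : Fin p → (ZMod q)ˣ) (x : Vqp q p) (j : Fin p) :
    diagPerm q p a x j = a j * x j := rfl

theorem diagPerm_injective (q p : ℕ) : Function.Injective (diagPerm q p) := by
  intro a b hab
  funext j
  have h := congrFun (Equiv.congr_fun hab 1) j
  simpa [diagPerm_apply, Units.ext_iff] using h

theorem diagPerm_mem_Hqp (q p : ℕ) [Fact q.Prime] (c : (ZMod q)ˣ) (a : Fin p → (ZMod q)ˣ)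
    (ha : ∀ i, a i ∈ Subgroup.zpowers c) : diagPerm q p a ∈ Hqp q p c := by
  change a ∈ (Hqp q p c).comap (diagPerm q p)
  refine Subgroup.pi_mem_of_mulSingle_mem a fun i => ?_
  obtain ⟨n, hn⟩ := Subgroup.mem_zpowers_iff.mp (ha i)
  rw [← hn, Pi.mulSingle_zpow]
  refine zpow_mem ?_ n
  have h : diagPerm q p (Pi.mulSingle i c) = scalePerm q p c i := by
    ext x j
    by_cases hj : j = i
    · subst hj
      simp [diagPerm_apply, scalePerm]
    · simp [diagPerm_apply, scalePerm, hj]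
  rw [Subgroup.mem_comap, h]
  exact Subgroup.subset_closure (Or.inl ⟨i, rfl⟩)

theorem Hqp_map_add (q p : ℕ) [NeZero p] [Fact q.Prime] {c : (ZMod q)ˣ}
    {h : Equiv.Perm (Vqp q p)} (hh : h ∈ Hqp q p c) (x y : Vqp q p) : h (x + y) = h x + h y := by
  obtain ⟨k, a, -, ha⟩ := Hqp_le_cyclicMonomial q p c hh
  funext j
  simp [ha, mul_add]

theorem HconjPerm_inf_HconjPerm (q p : ℕ) [NeZero p] [Fact q.Prime] (c : (ZMod q)ˣ)
    (v₁ v₂ : Vqp q p) :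
    HconjPerm q p c v₁ ⊓ HconjPerm q p c v₂ =
      (Hqp q p c ⊓ MulAction.stabilizer (Equiv.Perm (Vqp q p)) (v₁ - v₂)).map
        (MulAut.conj (Equiv.addLeft v₁)⁻¹).toMonoidHom := by
  have conj_apply : ∀ (v : Vqp q p) (h : Equiv.Perm (Vqp q p)) (x : Vqp q p),
      (MulAut.conj (Equiv.addLeft v)⁻¹).toMonoidHom h x = -v + h (v + x) := fun v h x => by
    simp [Equiv.Perm.inv_def]
  ext g
  constructor
  · rintro ⟨⟨h, hh, rfl⟩, ⟨h', hh', e⟩⟩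
    refine ⟨h, ⟨hh, ?_⟩, rfl⟩
    have h0 : h' 0 = 0 := by simpa using Hqp_map_add q p hh' 0 0
    have e₂ := Equiv.congr_fun e (-v₂)
    rw [conj_apply, conj_apply, add_neg_cancel, h0, ← sub_eq_add_neg] at e₂
    change h (v₁ - v₂) = v₁ - v₂
    rw [eq_neg_add_iff_add_eq] at e₂
    rw [← e₂]
    abel
  · rintro ⟨h, ⟨hh, hw⟩, rfl⟩
    refine ⟨⟨h, hh, rfl⟩, ⟨h, hh, ?_⟩⟩
    replace hw : h (v₁ - v₂) = v₁ - v₂ := hw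
    ext1 x
    rw [conj_apply, conj_apply, show v₁ + x = (v₁ - v₂) + (v₂ + x) by abel,
      Hqp_map_add q p hh (v₁ - v₂), hw]
    abel

theorem card_HconjPerm_inf_HconjPerm (q p : ℕ) [NeZero p] [Fact q.Prime] (c : (ZMod q)ˣ)
    (v₁ v₂ : Vqp q p) :
    Nat.card ↥(HconjPerm q p c v₁ ⊓ HconjPerm q p c v₂) =
      Nat.card ↥(Hqp q p c ⊓ MulAction.stabilizer (Equiv.Perm (Vqp q p)) (v₁ - v₂)) := by
  rw [HconjPerm_inf_HconjPerm]
  exact Subgroup.card_map_of_injective (MulEquiv.injective _)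

theorem card_Hqp_inf_stabilizer_le (q p : ℕ) [NeZero p] [Fact q.Prime] (c : (ZMod q)ˣ)
    (w : Vqp q p) (hw : ∀ i, w i ≠ 0) :
    Nat.card ↥(Hqp q p c ⊓ MulAction.stabilizer (Equiv.Perm (Vqp q p)) w) ≤ p := by
  choose k a _ ha using fun h : ↥(Hqp q p c ⊓ MulAction.stabilizer (Equiv.Perm (Vqp q p)) w) =>
    Hqp_le_cyclicMonomial q p c h.2.1
  have fixes : ∀ h j, (a h j : ZMod q) * w (j + k h) = w j := fun h j => by
    rw [← ha]
    exact congrFun h.2.2 j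
  have hinj : Function.Injective k := by
    intro g h hgh
    ext x j
    have hcoef : (a g j : ZMod q) = a h j := by
      apply mul_right_cancel₀ (hw (j + k g))
      rw [fixes, hgh, fixes]
    rw [ha, ha, hcoef, hgh]
  simpa using Nat.card_le_card_of_injective k hinj

theorem eq_zero_of_cyclicMonomial_fixed (q p : ℕ) [Fact p.Prime] {w : Vqp q p} (hw : w ≠ 0)
    (hz : ∃ i, w i = 0) {k : Fin p} {a : Fin p → (ZMod q)ˣ}
    (h : ∀ j, (a j : ZMod q) * w (j + k) = w j) : k = 0 := by
  by_contra hk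
  obtain ⟨i, hi⟩ := hz
  have iff_shift : ∀ j, w (j + k) = 0 ↔ w j = 0 := fun j => by
    rw [← h j, Units.mul_right_eq_zero]
  have all : ∀ n : ℕ, w (i + n • k) = 0 := fun n => by
    induction n with
    | zero => simpa using hi
    | succ n ih => rwa [succ_nsmul, ← add_assoc, iff_shift]
  apply hw
  funext j
  have hmem : j - i ∈ AddSubmonoid.multiples k :=
    mem_multiples_of_prime_card (p := p) (by simp) hk
  obtain ⟨n, hn⟩ := AddSubmonoid.mem_multiples_iff _ _ |>.mp hmem
  have hj := all n
  rwa [hn, add_sub_cancel] at hj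

theorem Hqp_inf_stabilizer_eq_map (q p : ℕ) [Fact p.Prime] [Fact q.Prime] (c : (ZMod q)ˣ)
    {w : Vqp q p} (hw : w ≠ 0) (hz : ∃ i, w i = 0) :
    Hqp q p c ⊓ MulAction.stabilizer (Equiv.Perm (Vqp q p)) w =
      (Subgroup.pi Set.univ fun i => if w i = 0 then Subgroup.zpowers c else ⊥).map
        (diagPerm q p) := by
  ext h
  constructor
  · rintro ⟨hh, hs⟩
    obtain ⟨k, a, ha, hka⟩ := Hqp_le_cyclicMonomial q p c hh
    have fixes : ∀ j, (a j : ZMod q) * w (j + k) = w j := fun j => by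
      rw [← hka]
      exact congrFun hs j
    obtain rfl := eq_zero_of_cyclicMonomial_fixed q p hw hz fixes
    refine ⟨a, fun i _ => ?_, ?_⟩
    · dsimp only
      split_ifs with hi
      · exact ha i
      · have := fixes i
        rw [add_zero, mul_eq_right₀ hi, Units.val_eq_one] at this
        exact this
    · ext x j
      rw [hka, diagPerm_apply, add_zero]
  · rintro ⟨a, ha, rfl⟩
    refine ⟨diagPerm_mem_Hqp q p c a fun i => ?_, ?_⟩
    · have := ha i trivial
      dsimp only at this
      split_ifs at this
      · exact this
      · rw [Subgroup.mem_bot.mp this]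
        exact one_mem _
    · change diagPerm q p a w = w
      funext i
      rw [diagPerm_apply]
      have := ha i trivial
      dsimp only at this
      split_ifs at this with hi
      · rw [hi, mul_zero]
      · rw [Subgroup.mem_bot.mp this, Units.val_one, one_mul]

theorem card_Hqp_inf_stabilizer (q p : ℕ) [Fact p.Prime] [Fact q.Prime] (c : (ZMod q)ˣ)
    {w : Vqp q p} (hw : w ≠ 0) (hz : ∃ i, w i = 0) :
    Nat.card ↥(Hqp q p c ⊓ MulAction.stabilizer (Equiv.Perm (Vqp q p)) w) =
      orderOf c ^ (Finset.univ.filter fun i => w i = 0).card := by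
  rw [Hqp_inf_stabilizer_eq_map q p c hw hz,
    Subgroup.card_map_of_injective (diagPerm_injective q p)]
  refine (Nat.card_congr (Equiv.Set.univPi fun i =>
    ((if w i = 0 then Subgroup.zpowers c else ⊥ : Subgroup (ZMod q)ˣ) : Set (ZMod q)ˣ))).trans ?_
  rw [Nat.card_pi, Finset.card_filter, ← Finset.prod_pow_eq_pow_sum]
  refine Finset.prod_congr rfl fun i _ => ?_
  split_ifs
  · rw [pow_one]
    exact Nat.card_zpowers c
  · rw [pow_zero]
    exact Subgroup.card_bot

/-- Lemma 8: for distinct `v₁, v₂ ∈ V`, with `Δ(v₁,v₂) = {i : v₁ i = v₂ i}`: if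
`|Δ(v₁,v₂)| = 0` then `|H^{v₁} ∩ H^{v₂}| ≤ p`, and if `|Δ(v₁,v₂)| = u ≠ 0` then
`|H^{v₁} ∩ H^{v₂}| = p^u`. -/
theorem card_inter_Hconj (p q : ℕ) [Fact p.Prime] [Fact q.Prime] (hpq : p ∣ q - 1)
    (c : (ZMod q)ˣ) (hc : orderOf c = p)
    (v₁ v₂ : Vqp q p) (hne : v₁ ≠ v₂) (u : ℕ)
    (hu : u = (Finset.univ.filter fun i : Fin p => v₁ i = v₂ i).card) :
    (u = 0 → Nat.card ↥(HconjPerm q p c v₁ ⊓ HconjPerm q p c v₂) ≤ p) ∧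
    (u ≠ 0 → Nat.card ↥(HconjPerm q p c v₁ ⊓ HconjPerm q p c v₂) = p ^ u) := by
  have hzero : ∀ i, (v₁ - v₂) i = 0 ↔ v₁ i = v₂ i := fun i => by
    rw [Pi.sub_apply, sub_eq_zero]
  rw [card_HconjPerm_inf_HconjPerm]
  constructor
  · intro h
    rw [hu, Finset.card_eq_zero, Finset.filter_eq_empty_iff] at h
    exact card_Hqp_inf_stabilizer_le q p c _ fun i hi => h (Finset.mem_univ i) ((hzero i).mp hi)
  · intro h
    rw [hu, Finset.card_ne_zero] at h
    obtain ⟨i, hi⟩ := h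
    rw [card_Hqp_inf_stabilizer q p c (sub_ne_zero.mpr hne)
      ⟨i, (hzero i).mpr (Finset.mem_filter.mp hi).2⟩, hc, hu]
    simp only [hzero]
end
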